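/- arXiv:0711.3832 — 4 statements merged into one kernel-verified Lean document; each statement's English description precedes it below -/
import Mathlib

section
/- A subgroup H of F is the centralizer in F of a pair of (possibly equal) elements of F if and only if there exist n ∈ ℕ, subgroups H₁, …, Hₙ of F, and points α₀, …, αₙ ∈ A with 0 = α₀ < α₁ < ⋯ < αₙ = r such that: (1) H is the internal direct product of H₁, …, Hₙ; (2) for every i = 1, …, n, either Hᵢ = {id}, or Hᵢ = F_{(α_{i−1},α_i)}, or there exists x ∈ F_{(α_{i−1},α_i)} such that Hᵢ is the centralizer of x in F_{(α_{i−1},α_i)} and Hᵢ = ⟨x⟩; (3) for every i = 1, …, n−1, if Hᵢ = F_{(α_{i−1},α_i)} then H_{i+1} ≠ F_{(α_i,α_{i+1})}. -/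
open Set

/-- `L` (the `Λ` of the paper) is a subgroup of the multiplicative group of positive reals. -/
def IsSlopeSubgroup (L : Set ℝ) : Prop :=
  (∀ p ∈ L, (0:ℝ) < p) ∧ (1:ℝ) ∈ L ∧ (∀ p ∈ L, ∀ q ∈ L, p * q ∈ L) ∧ ∀ p ∈ L, p⁻¹ ∈ L

/-- `A` is an additive subgroup of `ℝ`, containing `r`, stable under multiplication
by the elements of `L`. -/
def IsSlopeModule (r : ℝ) (L A : Set ℝ) : Prop :=
  r ∈ A ∧ (0:ℝ) ∈ A ∧ (∀ a ∈ A, ∀ b ∈ A, a + b ∈ A) ∧ (∀ a ∈ A, -a ∈ A) ∧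
    ∀ p ∈ L, ∀ a ∈ A, p * a ∈ A

/-- The support of a permutation of `ℝ`. -/
def psupp (f : Equiv.Perm ℝ) : Set ℝ := {x | f x ≠ x}

/-- `f` is affine with slope `k` on the set `s`. -/
def AffOn (f : ℝ → ℝ) (s : Set ℝ) (k : ℝ) : Prop := ∃ m, ∀ x ∈ s, f x = k * x + m

/-- `f` is piecewise affine with finitely many breakpoints, all breakpoints
(necessarily lying in `[0,r]`) and their images lying in `A`, and all slopes in `L`. -/
def PiecewiseAffine (r : ℝ) (L A : Set ℝ) (f : Equiv.Perm ℝ) : Prop :=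
  ∃ B : Finset ℝ, (B : Set ℝ) ⊆ A ∩ Icc 0 r ∧ (∀ x ∈ B, f x ∈ A) ∧
    ∀ x : ℝ, x ∉ (B : Set ℝ) → ∃ ε > 0, ∃ k ∈ L, AffOn (⇑f) (Ioo (x - ε) (x + ε)) k

/-- Membership in the group `F(r,L,A)`.  We model bijections of `[0,r)` onto itself
as permutations of `ℝ` fixing the complement of `[0,r)` pointwise.  An element of
`F(r,L,A)` is such a permutation which is continuous (equivalently, its restriction
to `[0,r)` is a homeomorphism of `[0,r)` for the usual topology) and piecewise
affine with all slopes in `L` and all breakpoints, together with their images, in `A`. -/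
def memF (r : ℝ) (L A : Set ℝ) (f : Equiv.Perm ℝ) : Prop :=
  (∀ x : ℝ, x ∉ Ico (0:ℝ) r → f x = x) ∧ Continuous ⇑f ∧ PiecewiseAffine r L A f

/-- Membership in `F_S(r,L,A) = {x ∈ F(r,L,A) : supp x ⊆ S}`. -/
def memFS (r : ℝ) (L A : Set ℝ) (S : Set ℝ) (f : Equiv.Perm ℝ) : Prop :=
  memF r L A f ∧ psupp f ⊆ S

/-- `f` has right slope `k` at `a`: `f` is affine with slope `k` on an interval
immediately to the right of `a`. -/
def HasRightSlope (f : ℝ → ℝ) (a k : ℝ) : Prop := ∃ b > a, AffOn f (Ioo a b) k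

/-- `f` has left slope `k` at `b`: `f` is affine with slope `k` on an interval
immediately to the left of `b`. -/
def HasLeftSlope (f : ℝ → ℝ) (b k : ℝ) : Prop := ∃ a < b, AffOn f (Ioo a b) k

/-- `H` is the internal direct product of the subgroups `Hs 0, …, Hs (n-1)`:
elements of distinct factors commute, and every element of `H` is, in a unique way,
the product of one element from each factor (in increasing order of the index). -/
def IsInternalDirectProduct {G : Type*} [Group G] (H : Subgroup G) (n : ℕ)
    (Hs : ℕ → Subgroup G) : Prop :=
  (∀ i < n, ∀ j < n, i ≠ j → ∀ x ∈ Hs i, ∀ y ∈ Hs j, Commute x y) ∧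
  ∀ g : G, g ∈ H ↔
    ∃! t : (i : Fin n) → ↥(Hs (i : ℕ)),
      g = (List.ofFn fun i : Fin n => ((t i : G))).prod

section PiecewiseLinearGerms

open Filter Topology

variable {r : ℝ} {L A : Set ℝ}

/-- `f` is affine with slope `k` on some interval `[p, p + ε)`. -/
def RightAff (f : ℝ → ℝ) (p k : ℝ) : Prop := ∀ᶠ t in 𝓝[≥] p, f t = f p + k * (t - p)

/-- `f` is affine with slope `k` on some interval `(p - ε, p]`. -/
def LeftAff (f : ℝ → ℝ) (p k : ℝ) : Prop := ∀ᶠ t in 𝓝[≤] p, f t = f p + k * (t - p)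

/-- The local condition at `p` that characterizes the elements of `F(r,L,A)`. -/
structure PLAt (L A : Set ℝ) (f : ℝ → ℝ) (p : ℝ) : Prop where
  right : ∃ k ∈ L, RightAff f p k
  left : ∃ k ∈ L, LeftAff f p k
  aff : p ∉ A → ∃ k ∈ L, ∀ᶠ t in 𝓝 p, f t = f p + k * (t - p)
  mem_iff : f p ∈ A ↔ p ∈ A

theorem tendsto_affine {f : ℝ → ℝ} {p k : ℝ} {s : Set ℝ}
    (h : ∀ᶠ t in 𝓝[s] p, f t = f p + k * (t - p)) : Tendsto f (𝓝[s] p) (𝓝 (f p)) := by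
  have h1 : Tendsto (fun t => f p + k * (t - p)) (𝓝[s] p) (𝓝 (f p)) := by
    have : ContinuousAt (fun t => f p + k * (t - p)) p := by fun_prop
    have := this.tendsto
    simp only [sub_self, mul_zero, add_zero] at this
    exact this.mono_left nhdsWithin_le_nhds
  exact h1.congr' (h.mono fun t ht => ht.symm)

theorem RightAff.tendsto {f : ℝ → ℝ} {p k : ℝ} (hk : 0 < k) (h : RightAff f p k) :
    Tendsto f (𝓝[≥] p) (𝓝[≥] (f p)) := by
  refine tendsto_nhdsWithin_iff.2 ⟨tendsto_affine h, ?_⟩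
  filter_upwards [h, self_mem_nhdsWithin] with t ht hp
  have : 0 ≤ k * (t - p) := mul_nonneg hk.le (sub_nonneg.2 hp)
  simp only [mem_Ici]; linarith

theorem LeftAff.tendsto {f : ℝ → ℝ} {p k : ℝ} (hk : 0 < k) (h : LeftAff f p k) :
    Tendsto f (𝓝[≤] p) (𝓝[≤] (f p)) := by
  refine tendsto_nhdsWithin_iff.2 ⟨tendsto_affine h, ?_⟩
  filter_upwards [h, self_mem_nhdsWithin] with t ht hp
  have : 0 ≤ k * (p - t) := mul_nonneg hk.le (sub_nonneg.2 hp)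
  simp only [mem_Iic]; linarith

theorem affine_comp {f g : ℝ → ℝ} {p k l : ℝ} {s s' : Set ℝ}
    (hf : ∀ᶠ t in 𝓝[s'] (g p), f t = f (g p) + k * (t - g p))
    (hg : ∀ᶠ t in 𝓝[s] p, g t = g p + l * (t - p))
    (ht : Tendsto g (𝓝[s] p) (𝓝[s'] (g p))) :
    ∀ᶠ t in 𝓝[s] p, (f ∘ g) t = (f ∘ g) p + (k * l) * (t - p) := by
  filter_upwards [ht.eventually hf, hg] with t h1 h2
  simp only [Function.comp]
  rw [h1, h2]; ring

theorem RightAff.comp {f g : ℝ → ℝ} {p k l : ℝ} (hl : 0 < l) (hf : RightAff f (g p) k)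
    (hg : RightAff g p l) : RightAff (f ∘ g) p (k * l) :=
  affine_comp hf hg (hg.tendsto hl)

theorem LeftAff.comp {f g : ℝ → ℝ} {p k l : ℝ} (hl : 0 < l) (hf : LeftAff f (g p) k)
    (hg : LeftAff g p l) : LeftAff (f ∘ g) p (k * l) :=
  affine_comp hf hg (hg.tendsto hl)

theorem PLAt.comp (hL : IsSlopeSubgroup L) {f g : ℝ → ℝ} {p : ℝ} (hf : PLAt L A f (g p))
    (hg : PLAt L A g p) : PLAt L A (f ∘ g) p := by
  obtain ⟨k, hk, hk'⟩ := hf.right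
  obtain ⟨l, hl, hl'⟩ := hg.right
  obtain ⟨k₁, hk₁, hk₁'⟩ := hf.left
  obtain ⟨l₁, hl₁, hl₁'⟩ := hg.left
  refine ⟨⟨_, hL.2.2.1 k hk l hl, hk'.comp (hL.1 l hl) hl'⟩,
    ⟨_, hL.2.2.1 k₁ hk₁ l₁ hl₁, hk₁'.comp (hL.1 l₁ hl₁) hl₁'⟩, fun hp => ?_,
    hf.mem_iff.trans hg.mem_iff⟩
  obtain ⟨l, hl, hl'⟩ := hg.aff hp
  obtain ⟨k, hk, hk'⟩ := hf.aff (fun h => hp (hg.mem_iff.1 h))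
  refine ⟨_, hL.2.2.1 k hk l hl, ?_⟩
  rw [← nhdsWithin_univ] at hk' hl' ⊢
  refine affine_comp hk' hl' ?_
  have := tendsto_affine hl'
  rw [nhdsWithin_univ] at this ⊢
  rwa [nhdsWithin_univ]

theorem affine_symm {f : Equiv.Perm ℝ} {p k : ℝ} (hk : 0 < k) {s s' : Set ℝ}
    (hs : ∀ t ∈ s', p + k⁻¹ * (t - f p) ∈ s)
    (h : ∀ᶠ t in 𝓝[s] p, f t = f p + k * (t - p)) :
    ∀ᶠ t in 𝓝[s'] (f p), f.symm t = f.symm (f p) + k⁻¹ * (t - f p) := by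
  have h1 : Tendsto (fun t => p + k⁻¹ * (t - f p)) (𝓝[s'] (f p)) (𝓝[s] p) := by
    refine tendsto_nhdsWithin_iff.2 ⟨?_, ?_⟩
    · have : ContinuousAt (fun t => p + k⁻¹ * (t - f p)) (f p) := by fun_prop
      have := this.tendsto
      simp only [sub_self, mul_zero, add_zero] at this
      exact this.mono_left nhdsWithin_le_nhds
    · filter_upwards [self_mem_nhdsWithin] with t ht using hs t ht
  filter_upwards [h1.eventually h] with t ht
  rw [Equiv.symm_apply_apply, Equiv.symm_apply_eq, ht]
  field_simp
  ring

theorem PLAt.symm (hL : IsSlopeSubgroup L) {f : Equiv.Perm ℝ} {p : ℝ} (hf : PLAt L A f p) :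
    PLAt L A f.symm (f p) := by
  obtain ⟨k, hk, hk'⟩ := hf.right
  obtain ⟨k₁, hk₁, hk₁'⟩ := hf.left
  refine ⟨⟨_, hL.2.2.2 k hk, affine_symm (hL.1 k hk) (fun t ht => ?_) hk'⟩,
    ⟨_, hL.2.2.2 k₁ hk₁, affine_symm (hL.1 k₁ hk₁) (fun t ht => ?_) hk₁'⟩, fun hp => ?_, ?_⟩
  · have := mul_nonneg (inv_pos.2 (hL.1 k hk)).le (sub_nonneg.2 ht)
    simp only [mem_Ici]; linarith
  · have := mul_nonneg (inv_pos.2 (hL.1 k₁ hk₁)).le (sub_nonneg.2 ht)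
    simp only [mem_Iic]; linarith
  · obtain ⟨k, hk, hk'⟩ := hf.aff (fun h => hp (hf.mem_iff.2 h))
    refine ⟨_, hL.2.2.2 k hk, ?_⟩
    rw [← nhdsWithin_univ] at hk' ⊢
    exact affine_symm (hL.1 k hk) (fun _ _ => mem_univ _) hk'
  · rw [Equiv.symm_apply_apply, hf.mem_iff]

theorem PLAt.congr {f g : ℝ → ℝ} {p : ℝ} (hf : PLAt L A f p) (h : f =ᶠ[𝓝 p] g) :
    PLAt L A g p := by
  have hp := h.eq_of_nhds
  obtain ⟨⟨k, hk, hk'⟩, ⟨l, hl, hl'⟩, h3, h4⟩ := hf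
  refine ⟨⟨k, hk, ?_⟩, ⟨l, hl, ?_⟩, fun hA => ?_, by rwa [← hp]⟩
  · filter_upwards [hk', h.filter_mono nhdsWithin_le_nhds] with t h1 h2
    rw [← h2, ← hp, h1]
  · filter_upwards [hl', h.filter_mono nhdsWithin_le_nhds] with t h1 h2
    rw [← h2, ← hp, h1]
  · obtain ⟨k, hk, h5⟩ := h3 hA
    refine ⟨k, hk, ?_⟩
    filter_upwards [h5, h] with t h1 h2
    rw [← h2, ← hp, h1]

theorem plAt_id (hL : IsSlopeSubgroup L) (p : ℝ) : PLAt L A (fun t => t) p :=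
  ⟨⟨1, hL.2.1, Eventually.of_forall fun t => by ring⟩,
    ⟨1, hL.2.1, Eventually.of_forall fun t => by ring⟩,
    fun _ => ⟨1, hL.2.1, Eventually.of_forall fun t => by ring⟩, Iff.rfl⟩

theorem PLAt.continuousAt {f : ℝ → ℝ} {p : ℝ} (hf : PLAt L A f p) : ContinuousAt f p := by
  obtain ⟨⟨k, -, hk⟩, ⟨l, -, hl⟩, -, -⟩ := hf
  rw [continuousAt_iff_continuous_left_right]
  exact ⟨tendsto_affine hl, tendsto_affine hk⟩

/-- The group `F(r,L,A)`, described by local conditions. -/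
def PLGroup (r : ℝ) (L A : Set ℝ) (hL : IsSlopeSubgroup L) : Subgroup (Equiv.Perm ℝ) where
  carrier := {f | (∀ x ∉ Ico (0 : ℝ) r, f x = x) ∧ ∀ p, PLAt L A f p}
  one_mem' := ⟨fun _ _ => rfl, fun p => plAt_id hL p⟩
  mul_mem' := by
    rintro f g ⟨hf, hf'⟩ ⟨hg, hg'⟩
    refine ⟨fun x hx => ?_, fun p => (hf' (g p)).comp hL (hg' p)⟩
    rw [Equiv.Perm.mul_apply, hg x hx, hf x hx]
  inv_mem' := by
    rintro f ⟨hf, hf'⟩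
    refine ⟨fun x hx => Equiv.Perm.inv_eq_iff_eq.2 (hf x hx).symm, fun p => ?_⟩
    have := (hf' (f.symm p)).symm hL
    rwa [Equiv.apply_symm_apply] at this

variable {hL : IsSlopeSubgroup L} {f g x y z : Equiv.Perm ℝ}

theorem continuous_of_mem (hf : f ∈ PLGroup r L A hL) : Continuous f :=
  continuous_iff_continuousAt.2 fun p => (hf.2 p).continuousAt

theorem strictMono_of_continuous (hf : Continuous f) (h : ∀ x ∉ Ico (0 : ℝ) r, f x = x) :
    StrictMono f := by
  rcases hf.strictMono_of_inj f.injective with h1 | h1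
  · exact h1
  · have h2 := h1 (show (-2 : ℝ) < -1 by norm_num)
    rw [h _ (by simp), h _ (by simp)] at h2
    norm_num at h2

theorem strictMono_of_mem (hf : f ∈ PLGroup r L A hL) : StrictMono f :=
  strictMono_of_continuous (continuous_of_mem hf) hf.1

theorem apply_zero_of_continuous (hf : Continuous f) (h : ∀ x ∉ Ico (0 : ℝ) r, f x = x) :
    f 0 = 0 := by
  have h1 : Tendsto f (𝓝[<] 0) (𝓝 (f 0)) := hf.continuousAt.tendsto.mono_left nhdsWithin_le_nhds
  have h2 : Tendsto f (𝓝[<] 0) (𝓝 0) := by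
    refine (tendsto_id.mono_left nhdsWithin_le_nhds).congr' ?_
    filter_upwards [self_mem_nhdsWithin] with t ht
    exact (h t (fun h' => not_lt.2 h'.1 ht)).symm
  exact tendsto_nhds_unique h1 h2

theorem apply_zero_of_mem (hf : f ∈ PLGroup r L A hL) : f 0 = 0 :=
  apply_zero_of_continuous (continuous_of_mem hf) hf.1

theorem apply_r_of_mem (hf : f ∈ PLGroup r L A hL) : f r = r := hf.1 r (by simp)

theorem apply_eq_of_notMem_Ioo (hf : f ∈ PLGroup r L A hL) {t : ℝ} (ht : t ∉ Ioo 0 r) :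
    f t = t := by
  rcases eq_or_ne t 0 with rfl | h0
  · exact apply_zero_of_mem hf
  · exact hf.1 t fun h => ht ⟨lt_of_le_of_ne h.1 h0.symm, h.2⟩

/-- A function that is locally affine on an open interval is affine on it. -/
theorem affine_of_locally_affine {f : ℝ → ℝ} {a b : ℝ} (hab : a < b)
    (h : ∀ x ∈ Ioo a b, ∃ ε > 0, ∃ k ∈ L, AffOn f (Ioo (x - ε) (x + ε)) k) :
    ∃ k ∈ L, AffOn f (Ioo a b) k := by
  have hloc : ∀ x ∈ Ioo a b, ∃ k ∈ L, ∃ m, f =ᶠ[𝓝 x] fun t => k * t + m := by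
    intro x hx
    obtain ⟨ε, hε, k, hk, m, hm⟩ := h x hx
    refine ⟨k, hk, m, ?_⟩
    filter_upwards [Ioo_mem_nhds (sub_lt_self x hε) (lt_add_of_pos_right x hε)] with t ht
      using hm t ht
  have han : AnalyticOnNhd ℝ f (Ioo a b) := by
    intro x hx
    obtain ⟨k, -, m, hm⟩ := hloc x hx
    refine AnalyticAt.congr ?_ hm.symm
    fun_prop
  have hc : (a + b) / 2 ∈ Ioo a b := ⟨by linarith, by linarith⟩
  obtain ⟨k, hk, m, hm⟩ := hloc _ hc
  refine ⟨k, hk, m, ?_⟩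
  have hg : AnalyticOnNhd ℝ (fun t => k * t + m) (Ioo a b) := fun x _ => by fun_prop
  exact han.eqOn_of_preconnected_of_eventuallyEq hg isPreconnected_Ioo hc hm

theorem AffOn.closure_of_continuous {f : ℝ → ℝ} {a b k : ℝ} (hf : Continuous f) (hab : a < b)
    (h : AffOn f (Ioo a b) k) : AffOn f (Icc a b) k := by
  obtain ⟨m, hm⟩ := h
  refine ⟨m, fun x hx => ?_⟩
  have h1 : EqOn f (fun x => k * x + m) (closure (Ioo a b)) :=
    EqOn.closure hm hf (by fun_prop)
  rw [closure_Ioo hab.ne] at h1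
  exact h1 hx

theorem exists_Ioo_disjoint (B : Finset ℝ) (p : ℝ) :
    ∃ ε > 0, (∀ t ∈ Ioo (p - ε) p, t ∉ B) ∧ ∀ t ∈ Ioo p (p + ε), t ∉ B := by
  have h : ((B.erase p : Finset ℝ) : Set ℝ)ᶜ ∈ 𝓝 p :=
    (Finset.finite_toSet _).isClosed.isOpen_compl.mem_nhds (by simp)
  obtain ⟨ε, hε, h1⟩ := Metric.mem_nhds_iff.1 h
  rw [Real.ball_eq_Ioo] at h1
  refine ⟨ε, hε, fun t ht hB => ?_, fun t ht hB => ?_⟩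
  · exact h1 ⟨ht.1, by linarith [ht.2]⟩ (by simp [hB, ht.2.ne])
  · exact h1 ⟨by linarith [ht.1], ht.2⟩ (by simp [hB, ht.1.ne'])

theorem mem_of_memF (hA : IsSlopeModule r L A) (hf : memF r L A f) :
    f ∈ PLGroup r L A hL := by
  obtain ⟨hfix, hcont, B, hB, hBA, hloc⟩ := hf
  have h0 := apply_zero_of_continuous hcont hfix
  obtain ⟨-, hA0, hAadd, hAneg, hAmul⟩ := hA
  refine ⟨hfix, fun p => ?_⟩
  obtain ⟨ε, hε, hl, hr'⟩ := exists_Ioo_disjoint B p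
  have hright : ∃ k ∈ L, RightAff f p k := by
    obtain ⟨k, hk, h⟩ := affine_of_locally_affine (f := f) (lt_add_of_pos_right p hε)
      fun x hx => hloc x (hr' x hx)
    obtain ⟨m, hm⟩ := h.closure_of_continuous hcont (lt_add_of_pos_right p hε)
    refine ⟨k, hk, ?_⟩
    filter_upwards [Icc_mem_nhdsGE (lt_add_of_pos_right p hε)] with t ht
    rw [hm t ht, hm p ⟨le_rfl, by linarith⟩]; ring
  have hleft : ∃ k ∈ L, LeftAff f p k := by
    obtain ⟨k, hk, h⟩ := affine_of_locally_affine (f := f) (sub_lt_self p hε)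
      fun x hx => hloc x (hl x hx)
    obtain ⟨m, hm⟩ := h.closure_of_continuous hcont (sub_lt_self p hε)
    refine ⟨k, hk, ?_⟩
    filter_upwards [Icc_mem_nhdsLE (sub_lt_self p hε)] with t ht
    rw [hm t ht, hm p ⟨by linarith, le_rfl⟩]; ring
  refine ⟨hright, hleft, fun hp => ?_, ?_⟩
  · obtain ⟨ε, hε, k, hk, m, hm⟩ := hloc p (fun h => hp (hB h).1)
    refine ⟨k, hk, ?_⟩
    filter_upwards [Ioo_mem_nhds (sub_lt_self p hε) (lt_add_of_pos_right p hε)] with t ht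
    rw [hm t ht, hm p ⟨by linarith, by linarith⟩]; ring
  · by_cases hp0 : p ∈ Ico 0 r
    swap
    · rw [hfix p hp0]
    by_cases hpB : p ∈ B
    · exact iff_of_true (hBA p hpB) (hB hpB).1
    obtain ⟨q, hq, hqmax⟩ := ((insert 0 B).filter (· ≤ p)).exists_max_image id
      ⟨0, by simp [hp0.1]⟩
    simp only [Finset.mem_filter, Finset.mem_insert, id] at hq hqmax
    have hqA : q ∈ A ∧ f q ∈ A := by
      rcases hq.1 with rfl | h
      · exact ⟨hA0, by rwa [h0]⟩
      · exact ⟨(hB h).1, hBA q h⟩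
    rcases hq.2.eq_or_lt with rfl | hqp
    · exact iff_of_true hqA.2 hqA.1
    obtain ⟨k, hk, h⟩ := affine_of_locally_affine (f := f) hqp fun x hx => hloc x fun hxB =>
        (hqmax x ⟨Or.inr hxB, hx.2.le⟩).not_gt hx.1
    obtain ⟨m, hm⟩ := h.closure_of_continuous hcont hqp
    have e : f p = f q + k * (p + -q) := by
      rw [hm p ⟨hqp.le, le_rfl⟩, hm q ⟨le_rfl, hqp.le⟩]; ring
    constructor
    · intro h1
      have e' : p = q + k⁻¹ * (f p + -f q) := by
        have := (hL.1 k hk).ne'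
        rw [e]; field_simp; ring
      rw [e']
      exact hAadd _ hqA.1 _ (hAmul _ (hL.2.2.2 k hk) _ (hAadd _ h1 _ (hAneg _ hqA.2)))
    · intro h1
      rw [e]
      exact hAadd _ hqA.2 _ (hAmul _ hk _ (hAadd _ h1 _ (hAneg _ hqA.1)))

theorem RightAff.affOn_near {f : ℝ → ℝ} {p k : ℝ} (h : RightAff f p k) :
    ∃ ε > 0, ∀ t ∈ Ico p (p + ε), f t = f p + k * (t - p) := by
  obtain ⟨u, hu, h⟩ := (mem_nhdsGE_iff_exists_Ico_subset).1 h
  exact ⟨u - p, sub_pos.2 hu, fun t ht => h ⟨ht.1, by linarith [ht.2]⟩⟩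

theorem LeftAff.affOn_near {f : ℝ → ℝ} {p k : ℝ} (h : LeftAff f p k) :
    ∃ ε > 0, ∀ t ∈ Ioc (p - ε) p, f t = f p + k * (t - p) := by
  obtain ⟨u, hu, h⟩ := (mem_nhdsLE_iff_exists_Ioc_subset).1 h
  exact ⟨p - u, sub_pos.2 hu, fun t ht => h ⟨by linarith [ht.1], ht.2⟩⟩

theorem memF_of_mem (hf : f ∈ PLGroup r L A hL) : memF r L A f := by
  refine ⟨hf.1, continuous_of_mem hf, ?_⟩
  have hU : ∀ p : ℝ, ∃ U ∈ 𝓝 p, ∀ x ∈ U, (x = p → p ∉ A) →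
      ∃ ε > 0, ∃ k ∈ L, AffOn f (Ioo (x - ε) (x + ε)) k := by
    intro p
    obtain ⟨k, hk, h⟩ := (hf.2 p).right
    obtain ⟨l, hl, h'⟩ := (hf.2 p).left
    obtain ⟨ε, hε, h⟩ := h.affOn_near
    obtain ⟨δ, hδ, h'⟩ := h'.affOn_near
    refine ⟨Ioo (p - δ) (p + ε), Ioo_mem_nhds (by linarith) (by linarith), fun x hx hxA => ?_⟩
    rcases lt_trichotomy x p with hxp | rfl | hxp
    · refine ⟨min (p - x) (x - (p - δ)), lt_min (by linarith) (by linarith [hx.1]), l, hl,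
        f p - l * p, fun t ht => ?_⟩
      have h1 := min_le_left (p - x) (x - (p - δ))
      have h2 := min_le_right (p - x) (x - (p - δ))
      rw [h' t ⟨by linarith [ht.1], by linarith [ht.2]⟩]; ring
    · obtain ⟨k, hk, h⟩ := (hf.2 x).aff (hxA rfl)
      obtain ⟨ε, hε, h⟩ := Metric.mem_nhds_iff.1 h
      rw [Real.ball_eq_Ioo] at h
      refine ⟨ε, hε, k, hk, f x - k * x, fun t ht => ?_⟩
      have := h ht
      simp only [mem_ofPred_eq] at this
      rw [this]; ring
    · refine ⟨min (x - p) ((p + ε) - x), lt_min (by linarith) (by linarith [hx.2]), k, hk,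
        f p - k * p, fun t ht => ?_⟩
      have h1 := min_le_left (x - p) ((p + ε) - x)
      have h2 := min_le_right (x - p) ((p + ε) - x)
      rw [h t ⟨by linarith [ht.1], by linarith [ht.2]⟩]; ring
  choose U hU hU' using hU
  obtain ⟨T, hT, hcov⟩ := (isCompact_Icc (a := (0 : ℝ)) (b := r)).elim_nhds_subcover U
    fun p _ => hU p
  classical
  refine ⟨T.filter (· ∈ A), fun x hx => ?_, fun x hx => ?_, fun x hx => ?_⟩
  · simp only [Finset.coe_filter, mem_ofPred_eq] at hx
    exact ⟨hx.2, hT x hx.1⟩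
  · rw [Finset.mem_filter] at hx
    exact (hf.2 x).mem_iff.2 hx.2
  · simp only [Finset.coe_filter, mem_ofPred_eq, not_and] at hx
    by_cases hxI : x ∈ Icc 0 r
    · obtain ⟨p, hp, hxp⟩ := mem_iUnion₂.1 (hcov hxI)
      exact hU' p x hxp fun h => by rw [← h]; exact hx (h ▸ hp)
    · obtain ⟨ε, hε, h⟩ := Metric.mem_nhds_iff.1 (isClosed_Icc.isOpen_compl.mem_nhds hxI)
      rw [Real.ball_eq_Ioo] at h
      refine ⟨ε, hε, 1, hL.2.1, 0, fun t ht => ?_⟩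
      rw [hf.1 t fun h' => h ht ⟨h'.1, h'.2.le⟩]; ring

theorem memF_iff (hA : IsSlopeModule r L A) :
    memF r L A f ↔ f ∈ PLGroup r L A hL :=
  ⟨mem_of_memF hA, memF_of_mem⟩

theorem exists_one_lt (hL : IsSlopeSubgroup L) (hLne : L ≠ {1}) : ∃ k ∈ L, 1 < k := by
  by_contra! h
  refine hLne (Subset.antisymm (fun k hk => ?_) (singleton_subset_iff.2 hL.2.1))
  have h1 := h k hk
  have h2 := h _ (hL.2.2.2 k hk)
  have h3 := (inv_le_one₀ (hL.1 k hk)).1 h2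
  exact le_antisymm h1 h3

theorem exists_small_mem (hr : 0 < r) (hL : IsSlopeSubgroup L) (hLne : L ≠ {1})
    (hA : IsSlopeModule r L A) {ε : ℝ} (hε : 0 < ε) : ∃ h ∈ A, 0 < h ∧ h < ε := by
  obtain ⟨k, hk, hk1⟩ := exists_one_lt hL hLne
  have hk0 := hL.1 k hk
  have hmem : ∀ n : ℕ, k⁻¹ ^ n * r ∈ A := by
    intro n
    induction n with
    | zero => simpa using hA.1
    | succ n ih =>
      rw [pow_succ', mul_assoc]
      exact hA.2.2.2.2 _ (hL.2.2.2 k hk) _ ih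
  obtain ⟨n, hn⟩ := exists_pow_lt_of_lt_one (div_pos hε hr) (inv_lt_one_of_one_lt₀ hk1)
  exact ⟨_, hmem n, by positivity, (lt_div_iff₀ hr).1 hn⟩

theorem affOn_near_of_isOpen {f : ℝ → ℝ} {k m p : ℝ} {U : Set ℝ} (hU : IsOpen U) (hp : p ∈ U)
    (h : ∀ t ∈ U, f t = k * t + m) : ∃ ε > 0, AffOn f (Ioo (p - ε) (p + ε)) k := by
  obtain ⟨ε, hε, h1⟩ := Metric.mem_nhds_iff.1 (hU.mem_nhds hp)
  rw [Real.ball_eq_Ioo] at h1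
  exact ⟨ε, hε, m, fun t ht => h t (h1 ht)⟩

/-- For `a < b` in `A ∩ [0,r]` there is an element of `F` with support exactly `(a,b)`. -/
theorem exists_bump (hr : 0 < r) (hLne : L ≠ {1}) (hA : IsSlopeModule r L A) {a b : ℝ}
    (ha : a ∈ A) (hb : b ∈ A) (ha0 : 0 ≤ a) (hab : a < b) (hbr : b ≤ r) :
    ∃ g ∈ PLGroup r L A hL, (∀ t ∈ Ioo a b, t < g t) ∧ ∀ t ∉ Ioo a b, g t = t := by
  obtain ⟨k, hk, hk1⟩ := exists_one_lt hL hLne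
  have hk0 := hL.1 k hk
  obtain ⟨h, hhA, hh0, hh⟩ := exists_small_mem hr hL hLne hA
    (div_pos (sub_pos.2 hab) (show 0 < 1 + k by linarith))
  rw [lt_div_iff₀ (by linarith)] at hh
  have hki : k * k⁻¹ = 1 := mul_inv_cancel₀ hk0.ne'
  have hki0 : 0 < k⁻¹ := inv_pos.2 hk0
  have hki1 : k⁻¹ < 1 := inv_lt_one_of_one_lt₀ hk1
  set G : ℝ → ℝ := fun t =>
    max t (min (min (a + k * (t - a)) (t + (k - 1) * h)) (b - k⁻¹ * (b - t))) with hG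
  have hm1 : StrictMono fun t : ℝ => a + k * (t - a) := fun s t hst => by
    simp only; nlinarith
  have hm2 : StrictMono fun t : ℝ => t + (k - 1) * h := fun s t hst => by simp only; linarith
  have hm3 : StrictMono fun t : ℝ => b - k⁻¹ * (b - t) := fun s t hst => by
    simp only; nlinarith
  have hmono : StrictMono G := fun s t hst =>
    max_lt_max hst (min_lt_min (min_lt_min (hm1 hst) (hm2 hst)) (hm3 hst))
  have hcont : Continuous G := by fun_prop
  have hkh : 0 < (k - 1) * h := mul_pos (by linarith) hh0
  have e1 : ∀ t ≤ a, G t = t := fun t ht => by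
    refine max_eq_left ((min_le_left _ _).trans ((min_le_left _ _).trans ?_))
    nlinarith
  have e5 : ∀ t, b ≤ t → G t = t := fun t ht => by
    refine max_eq_left ((min_le_right _ _).trans ?_)
    nlinarith
  have key : ∀ u v : ℝ, k * u ≤ v → (k - 1) * u ≤ (1 - k⁻¹) * v := fun u v huv => by
    have : (1 - k⁻¹) * (k * u) ≤ (1 - k⁻¹) * v :=
      mul_le_mul_of_nonneg_left huv (by linarith)
    have e : (1 - k⁻¹) * (k * u) = (k - 1) * u := by linear_combination (-u) * hki
    linarith
  have key' : ∀ u v : ℝ, v ≤ k * u → (1 - k⁻¹) * v ≤ (k - 1) * u := fun u v huv => by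
    have : (1 - k⁻¹) * v ≤ (1 - k⁻¹) * (k * u) :=
      mul_le_mul_of_nonneg_left huv (by linarith)
    have e : (1 - k⁻¹) * (k * u) = (k - 1) * u := by linear_combination (-u) * hki
    linarith
  have e2 : ∀ t ∈ Icc a (a + h), G t = a + k * (t - a) := fun t ht => by
    have h1 := key (t - a) (b - t) (by nlinarith [ht.1, ht.2])
    have h2 : (k - 1) * (t - a) ≤ (k - 1) * h :=
      mul_le_mul_of_nonneg_left (by linarith [ht.2]) (by linarith)
    have h3 : 0 ≤ (k - 1) * (t - a) := mul_nonneg (by linarith) (by linarith [ht.1])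
    simp only [hG]
    rw [min_eq_left (a := a + k * (t - a)) (by linarith), min_eq_left (by linarith),
      max_eq_right (by linarith)]
  have e3 : ∀ t ∈ Icc (a + h) (b - k * h), G t = t + (k - 1) * h := fun t ht => by
    have h1 := key h (b - t) (by linarith [ht.2])
    have h2 : (k - 1) * h ≤ (k - 1) * (t - a) :=
      mul_le_mul_of_nonneg_left (by linarith [ht.1]) (by linarith)
    simp only [hG]
    rw [min_eq_right (a := a + k * (t - a)) (by linarith), min_eq_left (by linarith),
      max_eq_right (by linarith)]
  have e4 : ∀ t ∈ Icc (b - k * h) b, G t = b - k⁻¹ * (b - t) := fun t ht => by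
    have h1 := key' h (b - t) (by linarith [ht.1])
    have h2 : (k - 1) * h ≤ (k - 1) * (t - a) :=
      mul_le_mul_of_nonneg_left (by linarith [ht.1]) (by linarith)
    have h3 : 0 ≤ (1 - k⁻¹) * (b - t) := mul_nonneg (by linarith) (by linarith [ht.2])
    simp only [hG]
    rw [min_eq_right (a := a + k * (t - a)) (by linarith), min_eq_right (by linarith),
      max_eq_right (by linarith)]
  have hsurj : Function.Surjective G := by
    refine hcont.surjective ?_ ?_
    · exact tendsto_atTop_mono (fun t => le_max_left _ _) tendsto_id
    · refine tendsto_id.congr' ?_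
      filter_upwards [eventually_le_atBot a] with t ht using (e1 t ht).symm
  have hfix : ∀ t ∉ Ioo a b, G t = t := fun t ht => by
    rcases le_or_gt t a with h1 | h1
    · exact e1 t h1
    · exact e5 t (not_lt.1 fun h2 => ht ⟨h1, h2⟩)
  obtain ⟨hA_r, hA0, hAadd, hAneg, hAmul⟩ := hA
  have hkA : k * h ∈ A := hAmul k hk h hhA
  have hk1A : (k - 1) * h ∈ A := by
    have := hAadd _ hkA _ (hAneg _ hhA)
    convert this using 1; ring
  have hahA : a + h ∈ A := hAadd _ ha _ hhA
  have hbkA : b - k * h ∈ A := by rw [sub_eq_add_neg]; exact hAadd _ hb _ (hAneg _ hkA)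
  have hbij : Function.Bijective G := ⟨hmono.injective, hsurj⟩
  refine ⟨Equiv.ofBijective G hbij, mem_of_memF ⟨hA_r, hA0, hAadd, hAneg, hAmul⟩
    ⟨fun t ht => ?_, hcont, ?_⟩,
    fun t ht => ?_, hfix⟩
  · exact hfix t fun h => ht ⟨by linarith [h.1], by linarith [h.2]⟩
  · refine ⟨{a, a + h, b - k * h, b}, ?_, ?_, fun t ht => ?_⟩
    · intro t ht
      simp only [Finset.coe_insert, Finset.coe_singleton, mem_insert_iff, mem_singleton_iff] at ht
      rcases ht with rfl | rfl | rfl | rfl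
      · exact ⟨ha, ha0, by linarith⟩
      · exact ⟨hahA, by linarith, by nlinarith⟩
      · exact ⟨hbkA, by nlinarith, by nlinarith⟩
      · exact ⟨hb, by linarith, hbr⟩
    · intro t ht
      simp only [Finset.mem_insert, Finset.mem_singleton] at ht
      simp only [Equiv.ofBijective_apply]
      rcases ht with rfl | rfl | rfl | rfl
      · rwa [e1 _ le_rfl]
      · rw [e3 _ ⟨le_rfl, by linarith⟩]; exact hAadd _ hahA _ hk1A
      · rw [e3 _ ⟨by linarith, le_rfl⟩]; exact hAadd _ hbkA _ hk1A
      · rwa [e5 _ le_rfl]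
    · simp only [Finset.coe_insert, Finset.coe_singleton, mem_insert_iff, mem_singleton_iff,
        not_or] at ht
      obtain ⟨t1, t2, t3, t4⟩ := ht
      simp only [Equiv.coe_ofBijective]
      have aux : ∀ {l m : ℝ} {U : Set ℝ}, IsOpen U → t ∈ U → l ∈ L →
          (∀ t ∈ U, G t = l * t + m) → ∃ ε > 0, ∃ k ∈ L, AffOn G (Ioo (t - ε) (t + ε)) k :=
        fun hU ht hl h => by
          obtain ⟨ε, hε, h'⟩ := affOn_near_of_isOpen hU ht h
          exact ⟨ε, hε, _, hl, h'⟩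
      rcases lt_or_gt_of_ne t1 with h1 | h1
      · exact aux (m := 0) isOpen_Iio h1 hL.2.1 fun t ht => by rw [e1 t (le_of_lt ht)]; ring
      rcases lt_or_gt_of_ne t2 with h2 | h2
      · exact aux (m := a - k * a) isOpen_Ioo ⟨h1, h2⟩ hk fun t ht => by
          rw [e2 t ⟨ht.1.le, ht.2.le⟩]; ring
      rcases lt_or_gt_of_ne t3 with h3 | h3
      · exact aux (m := (k - 1) * h) isOpen_Ioo ⟨h2, h3⟩ hL.2.1 fun t ht => by
          rw [e3 t ⟨ht.1.le, ht.2.le⟩]; ring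
      rcases lt_or_gt_of_ne t4 with h4 | h4
      · exact aux (m := b - k⁻¹ * b) isOpen_Ioo ⟨h3, h4⟩ (hL.2.2.2 k hk) fun t ht => by
          rw [e4 t ⟨ht.1.le, ht.2.le⟩]; ring
      · exact aux (m := 0) isOpen_Ioi h4 hL.2.1 fun t ht => by rw [e5 t (le_of_lt ht)]; ring
  · simp only [Equiv.ofBijective_apply, hG]
    refine lt_max_of_lt_right (lt_min (lt_min ?_ (by linarith)) ?_)
    · nlinarith [ht.1]
    · nlinarith [ht.2]

theorem mem_Ioo_iff_of_fixed {f : ℝ → ℝ} (hf : StrictMono f) {a b : ℝ} (ha : f a = a)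
    (hb : f b = b) (t : ℝ) : f t ∈ Ioo a b ↔ t ∈ Ioo a b := by
  constructor
  · rintro ⟨h1, h2⟩
    rw [← ha] at h1; rw [← hb] at h2
    exact ⟨hf.lt_iff_lt.1 h1, hf.lt_iff_lt.1 h2⟩
  · rintro ⟨h1, h2⟩
    have h1 := hf h1
    have h2 := hf h2
    rw [ha] at h1; rw [hb] at h2
    exact ⟨h1, h2⟩

/-- An element of `F` fixing two points of `A` can be cut down to the interval between them. -/
theorem exists_restrict (hz : z ∈ PLGroup r L A hL) {a b : ℝ} (ha : a ∈ A) (hb : b ∈ A)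
    (hab : a < b) (hza : z a = a) (hzb : z b = b) :
    ∃ w ∈ PLGroup r L A hL, (∀ t ∈ Ioo a b, w t = z t) ∧ ∀ t ∉ Ioo a b, w t = t := by
  classical
  have hmono := strictMono_of_mem hz
  set w : Equiv.Perm ℝ := Equiv.Perm.ofSubtype (p := (· ∈ Ioo a b))
    (z.subtypePerm (mem_Ioo_iff_of_fixed hmono hza hzb)) with hw
  have h1 : ∀ t ∈ Ioo a b, w t = z t := fun t ht => by
    rw [hw, Equiv.Perm.ofSubtype_apply_of_mem _ ht]; rfl
  have h2 : ∀ t ∉ Ioo a b, w t = t := fun t ht => Equiv.Perm.ofSubtype_apply_of_not_mem _ ht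
  have h1' : ∀ t ∈ Icc a b, w t = z t := fun t ht => by
    rcases ht.1.eq_or_lt with rfl | h3
    · rw [hza]; exact h2 _ (by simp)
    rcases ht.2.eq_or_lt with rfl | h4
    · rw [hzb]; exact h2 _ (by simp)
    exact h1 t ⟨h3, h4⟩
  refine ⟨w, ⟨fun t ht => ?_, fun p => ?_⟩, h1, h2⟩
  · by_cases h : t ∈ Ioo a b
    · rw [h1 t h, hz.1 t ht]
    · exact h2 t h
  · have hid := plAt_id (A := A) hL p
    have hzp := hz.2 p
    rcases lt_trichotomy p a with h | rfl | h
    · refine hid.congr ?_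
      filter_upwards [Iio_mem_nhds h] with t ht
      exact (h2 t fun h' => lt_asymm ht h'.1).symm
    · obtain ⟨k, hk, h⟩ := hzp.right
      refine ⟨⟨k, hk, ?_⟩, ⟨1, hL.2.1, ?_⟩, fun h => absurd ha h, ?_⟩
      · filter_upwards [h, Icc_mem_nhdsGE hab] with t ht ht'
        rw [h1' t ht', ht, h1' p ⟨le_rfl, hab.le⟩]
      · filter_upwards [self_mem_nhdsWithin] with t ht
        rw [h2 t fun h' => not_lt.2 ht h'.1, h2 p (by simp)]; ring
      · rw [h2 p (by simp)]
    rcases lt_trichotomy p b with h' | rfl | h'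
    · refine hzp.congr ?_
      filter_upwards [Ioo_mem_nhds h h'] with t ht using (h1 t ht).symm
    · obtain ⟨k, hk, h⟩ := hzp.left
      refine ⟨⟨1, hL.2.1, ?_⟩, ⟨k, hk, ?_⟩, fun h => absurd hb h, ?_⟩
      · filter_upwards [self_mem_nhdsWithin] with t ht
        rw [h2 t fun h' => not_lt.2 ht h'.2, h2 p (by simp)]; ring
      · filter_upwards [h, Icc_mem_nhdsLE hab] with t ht ht'
        rw [h1' t ht', ht, h1' p ⟨hab.le, le_rfl⟩]
      · rw [h2 p (by simp)]
    · refine hid.congr ?_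
      filter_upwards [Ioi_mem_nhds h'] with t ht
      exact (h2 t fun h'' => lt_asymm ht h''.2).symm

/-- The group `F_{(a,b)}` is not abelian. -/
theorem exists_not_commute (hr : 0 < r) (hLne : L ≠ {1}) (hA : IsSlopeModule r L A) {a b : ℝ}
    (ha : a ∈ A) (hb : b ∈ A) (ha0 : 0 ≤ a) (hab : a < b) (hbr : b ≤ r) :
    ∃ f ∈ PLGroup r L A hL, ∃ g ∈ PLGroup r L A hL, (∀ t ∉ Ioo a b, f t = t) ∧
      (∀ t ∉ Ioo a b, g t = t) ∧ ¬ Commute f g := by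
  obtain ⟨h, hhA, hh0, hh⟩ := exists_small_mem hr hL hLne hA (sub_pos.2 hab)
  have hc : a + h ∈ A := hA.2.2.1 _ ha _ hhA
  obtain ⟨f, hf, hf1, hf2⟩ := exists_bump (hL := hL) hr hLne hA ha hb ha0 hab hbr
  obtain ⟨g, hg, hg1, hg2⟩ := exists_bump (hL := hL) hr hLne hA ha hc ha0 (by linarith)
    (by linarith)
  refine ⟨f, hf, g, hg, hf2, fun t ht => hg2 t fun h' => ht ⟨h'.1, by linarith [h'.2]⟩,
    fun hcomm => ?_⟩
  obtain ⟨c', hc'⟩ := f.surjective (a + h)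
  have hmem : c' ∈ Ioo a b := by
    rw [← mem_Ioo_iff_of_fixed (strictMono_of_mem hf) (hf2 a (by simp)) (hf2 b (by simp)), hc']
    exact ⟨by linarith, by linarith⟩
  have h1 := hf1 c' hmem
  have h2 := hg1 c' ⟨hmem.1, by linarith⟩
  have h3 : f (g c') = g (f c') := by
    have := congrArg (fun p : Equiv.Perm ℝ => p c') hcomm.eq
    simpa using this
  rw [hc', hg2 (a + h) (by simp), ← hc'] at h3
  exact h2.ne' (f.injective h3)

theorem exists_orbit_lt {f : ℝ → ℝ} (hf : Continuous f) {c d : ℝ} (h : ∀ t ∈ Ioo c d, f t < t)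
    {S : Set ℝ} (hS : S ⊆ Ioo c d) (hne : S.Nonempty) (hfS : ∀ t ∈ S, f t ∈ S) {u : ℝ}
    (hu : c < u) : ∃ s ∈ S, s < u := by
  by_contra! hcon
  have hbdd : BddBelow S := ⟨c, fun s hs => (hS hs).1.le⟩
  have h1 : u ≤ sInf S := le_csInf hne hcon
  obtain ⟨s₀, hs₀⟩ := hne
  have h2 : sInf S < d := (csInf_le hbdd hs₀).trans_lt (hS hs₀).2
  have h3 : f (sInf S) < sInf S := h _ ⟨hu.trans_le h1, h2⟩
  obtain ⟨ε, hε, h4⟩ := Metric.mem_nhds_iff.1 (hf.continuousAt.eventually (Iio_mem_nhds h3))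
  rw [Real.ball_eq_Ioo] at h4
  obtain ⟨s, hs, hs'⟩ := exists_lt_of_csInf_lt ⟨s₀, hs₀⟩ (lt_add_of_pos_right (sInf S) hε)
  have h5 : f s < sInf S := h4 ⟨by linarith [csInf_le hbdd hs], hs'⟩
  exact (csInf_le hbdd (hfS s hs)).not_gt h5

theorem exists_orbit_gt {f : ℝ → ℝ} (hf : Continuous f) {c d : ℝ} (h : ∀ t ∈ Ioo c d, t < f t)
    {S : Set ℝ} (hS : S ⊆ Ioo c d) (hne : S.Nonempty) (hfS : ∀ t ∈ S, f t ∈ S) {u : ℝ}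
    (hu : u < d) : ∃ s ∈ S, u < s := by
  obtain ⟨s, hs, hsu⟩ := exists_orbit_lt (f := fun t => -f (-t)) (c := -d) (d := -c) (S := -S)
    (u := -u) (by fun_prop) (fun t ht => by
      have := h (-t) ⟨by linarith [ht.2], by linarith [ht.1]⟩
      linarith)
    (fun t ht => by
      have := hS (Set.mem_neg.1 ht)
      exact ⟨by linarith [this.2], by linarith [this.1]⟩)
    hne.neg (fun t ht => by simpa using hfS _ (Set.mem_neg.1 ht)) (by linarith)
  exact ⟨-s, hs, by linarith⟩

theorem lt_or_gt_of_no_fixed {f : ℝ → ℝ} (hf : Continuous f) {c d : ℝ}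
    (h : ∀ t ∈ Ioo c d, f t ≠ t) : (∀ t ∈ Ioo c d, f t < t) ∨ ∀ t ∈ Ioo c d, t < f t := by
  by_contra! hcon
  obtain ⟨⟨u, hu, hu'⟩, v, hv, hv'⟩ := hcon
  obtain ⟨t, ht, ht'⟩ := isPreconnected_Ioo.intermediate_value₂ hv hu hf.continuousOn
    continuousOn_id hv' hu'
  exact h t ht ht'

theorem Commute.perm_apply (h : Commute x z) (t : ℝ) : x (z t) = z (x t) := by
  simpa using congrArg (fun p : Equiv.Perm ℝ => p t) h.eq

theorem eq_of_fixed_of_lt (hx : x ∈ PLGroup r L A hL) (hz : z ∈ PLGroup r L A hL)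
    (hxz : Commute x z) {c d p : ℝ} (hc : x c = c) (hd : x d = d) (h : ∀ t ∈ Ioo c d, x t < t)
    (hp : p ∈ Ioo c d) (hzp : z p = p) : ∀ t ∈ Ioo c d, z t = t := by
  have hxI := mem_Ioo_iff_of_fixed (strictMono_of_mem hx) hc hd
  obtain ⟨s, -, hs⟩ := (hz.2 c).right
  obtain ⟨ε, hε, hs⟩ := hs.affOn_near
  have hfix : ∀ u > c, ∃ q ∈ {t ∈ Ioo c d | z t = t}, q < u := fun u hu =>
    exists_orbit_lt (S := {t ∈ Ioo c d | z t = t}) (continuous_of_mem hx) h (sep_subset _ _)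
      ⟨p, hp, hzp⟩
      (fun t ht => ⟨(hxI t).2 ht.1, by rw [← hxz.perm_apply, ht.2]⟩) hu
  obtain ⟨p₁, ⟨⟨hp₁, -⟩, hzp₁⟩, hp₁'⟩ := hfix (c + ε) (by linarith)
  obtain ⟨p₂, ⟨⟨hp₂, -⟩, hzp₂⟩, hp₂'⟩ := hfix p₁ hp₁
  have e₁ := hs p₁ ⟨hp₁.le, hp₁'⟩
  have e₂ := hs p₂ ⟨hp₂.le, hp₂'.trans hp₁'⟩
  rw [hzp₁] at e₁
  rw [hzp₂] at e₂
  have hs1 : s = 1 := by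
    have : (s - 1) * (p₁ - p₂) = 0 := by linear_combination e₂ - e₁
    rcases mul_eq_zero.1 this with h' | h' <;> linarith
  subst hs1
  by_contra! hcon
  obtain ⟨t, ht, hzt⟩ := hcon
  obtain ⟨q, ⟨hq, hzq⟩, hq'⟩ := exists_orbit_lt (S := {t ∈ Ioo c d | z t ≠ t})
    (continuous_of_mem hx) h (sep_subset _ _) ⟨t, ht, hzt⟩
    (fun t ht => ⟨(hxI t).2 ht.1, by rw [← hxz.perm_apply]; exact fun h => ht.2 (x.injective h)⟩)
    (show c < c + ε by linarith)
  exact hzq (by linarith [hs q ⟨hq.1.le, hq'⟩])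

/-- An element commuting with `x` and fixing a point of a component of the support of `x`
is the identity on that component. -/
theorem eq_of_fixed (hx : x ∈ PLGroup r L A hL) (hz : z ∈ PLGroup r L A hL)
    (hxz : Commute x z) {c d p : ℝ} (hc : x c = c) (hd : x d = d) (h : ∀ t ∈ Ioo c d, x t ≠ t)
    (hp : p ∈ Ioo c d) (hzp : z p = p) : ∀ t ∈ Ioo c d, z t = t := by
  rcases lt_or_gt_of_no_fixed (continuous_of_mem hx) h with h' | h'
  · exact eq_of_fixed_of_lt hx hz hxz hc hd h' hp hzp
  · have hc' : x⁻¹ c = c := Equiv.Perm.inv_eq_iff_eq.2 hc.symm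
    have hd' : x⁻¹ d = d := Equiv.Perm.inv_eq_iff_eq.2 hd.symm
    have hx' := inv_mem hx
    refine eq_of_fixed_of_lt hx' hz hxz.inv_left hc' hd' (fun t ht => ?_) hp hzp
    have := h' _ ((mem_Ioo_iff_of_fixed (strictMono_of_mem hx') hc' hd' t).2 ht)
    simpa using this

/-- The component of the support of `f` containing a given point. -/
theorem exists_component (hf : f ∈ PLGroup r L A hL) {t : ℝ} (ht : f t ≠ t) :
    ∃ c d, c < t ∧ t < d ∧ f c = c ∧ f d = d ∧ ∀ s ∈ Ioo c d, f s ≠ s := by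
  have htI : t ∈ Ioo 0 r := by
    by_contra h
    exact ht (apply_eq_of_notMem_Ioo hf h)
  have hcl : IsClosed {s | f s = s} := isClosed_eq (continuous_of_mem hf) continuous_id
  obtain ⟨c, ⟨⟨hc0, hct⟩, hc⟩, hcmax⟩ := (isCompact_Icc.inter_right hcl).exists_isGreatest
    (⟨0, ⟨le_rfl, htI.1.le⟩, apply_zero_of_mem hf⟩ : (Icc 0 t ∩ {s | f s = s}).Nonempty)
  obtain ⟨d, ⟨⟨hdt, hdr⟩, hd⟩, hdmin⟩ := (isCompact_Icc.inter_right hcl).exists_isLeast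
    (⟨r, ⟨htI.2.le, le_rfl⟩, apply_r_of_mem hf⟩ : (Icc t r ∩ {s | f s = s}).Nonempty)
  refine ⟨c, d, lt_of_le_of_ne hct fun h => ht (h ▸ hc), lt_of_le_of_ne hdt fun h => ht (h ▸ hd),
    hc, hd, fun s hs hfs => ?_⟩
  have hsI : s ∈ Icc 0 r := ⟨hc0.trans hs.1.le, hs.2.le.trans hdr⟩
  rcases le_total s t with h' | h'
  · exact (hcmax ⟨⟨hsI.1, h'⟩, hfs⟩).not_gt hs.1
  · exact (hdmin ⟨⟨h', hsI.2⟩, hfs⟩).not_gt hs.2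

/-- `f` is the identity near `p`. -/
def LocId (f : ℝ → ℝ) (p : ℝ) : Prop := ∀ᶠ t in 𝓝 p, f t = t

/-- `p` is a boundary point of the fixed point set of `f`. -/
def FixBdry (f : ℝ → ℝ) (p : ℝ) : Prop := f p = p ∧ ¬ LocId f p

theorem isOpen_locId (f : ℝ → ℝ) : IsOpen {p | LocId f p} := isOpen_setOfPred_eventually_nhds

theorem LocId.eq {f : ℝ → ℝ} {p : ℝ} (h : LocId f p) : f p = p := h.self_of_nhds

theorem locId_of_fixed (hx : x ∈ PLGroup r L A hL) (hz : z ∈ PLGroup r L A hL)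
    (hxz : Commute x z) {p : ℝ} (hp : z p = p) (hxp : x p ≠ p) : LocId z p := by
  obtain ⟨c, d, hc, hd, hxc, hxd, h⟩ := exists_component hx hxp
  filter_upwards [Ioo_mem_nhds hc hd] with t ht
  exact eq_of_fixed hx hz hxz hxc hxd h ⟨hc, hd⟩ hp t ht

/-- At a point outside `A`, an element of `F` is affine, so that it is the identity as soon as
its fixed points accumulate there. -/
theorem locId_of_mem_closure (hz : z ∈ PLGroup r L A hL) {p : ℝ} (hp : p ∉ A)
    (h : p ∈ closure {t | LocId z t}) : LocId z p := by
  have hzp : z p = p := by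
    have hcl : IsClosed {s | z s = s} := isClosed_eq (continuous_of_mem hz) continuous_id
    exact closure_minimal (fun t ht => LocId.eq ht) hcl h
  obtain ⟨k, -, hk⟩ := (hz.2 p).aff hp
  by_cases h1 : LocId z p
  · exact h1
  obtain ⟨t, ht, hzt⟩ := ((mem_closure_iff_frequently.1 h).and_eventually hk).exists
  have hzt' := LocId.eq ht
  have htp : t ≠ p := fun h' => h1 (h' ▸ ht)
  have hk1 : k = 1 := by
    rw [hzp, hzt'] at hzt
    have : (k - 1) * (t - p) = 0 := by linear_combination -hzt
    rcases mul_eq_zero.1 this with h' | h'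
    · linarith
    · exact absurd (sub_eq_zero.1 h') htp
  subst hk1
  filter_upwards [hk] with s hs
  rw [hs, hzp]; ring

/-- On the interval `(a,b)` the elements `x` and `y` are nowhere both locally trivial, and
all boundary points of their fixed point sets lie outside `A`. -/
def IrredOn (A : Set ℝ) (x y : ℝ → ℝ) (a b : ℝ) : Prop :=
  ∀ p ∈ Ioo a b, ¬ (LocId x p ∧ LocId y p) ∧ (p ∈ A → ¬ FixBdry x p ∧ ¬ FixBdry y p)

theorem IrredOn.eq_id {a b q : ℝ} (h : IrredOn A x y a b) (hx : x ∈ PLGroup r L A hL)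
    (hy : y ∈ PLGroup r L A hL) (hz : z ∈ PLGroup r L A hL) (hxz : Commute x z)
    (hyz : Commute y z) (hq : q ∈ Ioo a b) (hzq : LocId z q) : ∀ t ∈ Ioo a b, z t = t := by
  suffices Ioo a b ⊆ {t | LocId z t} from fun t ht => LocId.eq (this ht)
  refine isPreconnected_Ioo.subset_of_closure_inter_subset (isOpen_locId z) ⟨q, hq, hzq⟩ ?_
  rintro p ⟨hp, hpI⟩
  have hzp : z p = p := by
    have hcl : IsClosed {s | z s = s} := isClosed_eq (continuous_of_mem hz) continuous_id
    exact closure_minimal (fun t ht => LocId.eq ht) hcl hp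
  by_cases hxp : x p = p
  swap
  · exact locId_of_fixed hx hz hxz hzp hxp
  by_cases hyp : y p = p
  swap
  · exact locId_of_fixed hy hz hyz hzp hyp
  obtain ⟨h1, h2⟩ := h p hpI
  refine locId_of_mem_closure hz (fun hpA => ?_) hp
  have h3 := h2 hpA
  simp only [FixBdry, hxp, hyp, true_and, not_not] at h3
  exact h1 h3

theorem irredOn_of_ne {a b : ℝ} (hx : x ∈ PLGroup r L A hL) (hy : y ∈ PLGroup r L A hL)
    (h : ∀ p ∈ Ioo a b, p ∈ A → ¬ FixBdry x p ∧ ¬ FixBdry y p)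
    (hne : ∃ t ∈ Ioo a b, x t ≠ t ∨ y t ≠ t) : IrredOn A x y a b := by
  refine fun p hp => ⟨fun hxy => ?_, h p hp⟩
  have key : Ioo a b ⊆ {t | LocId x t} ∩ {t | LocId y t} := by
    refine isPreconnected_Ioo.subset_of_closure_inter_subset
      ((isOpen_locId x).inter (isOpen_locId y)) ⟨p, hp, hxy⟩ ?_
    rintro q ⟨hq, hqI⟩
    have hqx := closure_mono inter_subset_left hq
    have hqy := closure_mono inter_subset_right hq
    by_cases hqA : q ∈ A
    · have hfix : ∀ w ∈ PLGroup r L A hL, q ∈ closure {t | LocId w t} → w q = q := by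
        intro w hw hqw
        have hcl : IsClosed {s | w s = s} := isClosed_eq (continuous_of_mem hw) continuous_id
        exact closure_minimal (fun t ht => LocId.eq ht) hcl hqw
      have h3 := h q hqI hqA
      simp only [FixBdry, hfix x hx hqx, hfix y hy hqy, true_and, not_not] at h3
      exact h3
    · exact ⟨locId_of_mem_closure hx hqA hqx, locId_of_mem_closure hy hqA hqy⟩
  obtain ⟨t, ht, hxt | hyt⟩ := hne
  · exact hxt (key ht).1.eq
  · exact hyt (key ht).2.eq

theorem exists_locId_right {f : ℝ → ℝ} {a b : ℝ} (hab : a < b) (h : ∀ᶠ t in 𝓝[>] a, f t = t) :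
    ∃ q ∈ Ioo a b, LocId f q := by
  obtain ⟨u, hu, h⟩ := (mem_nhdsGT_iff_exists_Ioo_subset).1 h
  obtain ⟨q, hq, hq'⟩ := exists_between (lt_min hu hab)
  exact ⟨q, ⟨hq, hq'.trans_le (min_le_right _ _)⟩,
    Filter.mem_of_superset (Ioo_mem_nhds hq (hq'.trans_le (min_le_left _ _))) h⟩

theorem exists_locId_left {f : ℝ → ℝ} {a b : ℝ} (hab : a < b) (h : ∀ᶠ t in 𝓝[<] b, f t = t) :
    ∃ q ∈ Ioo a b, LocId f q := by
  obtain ⟨u, hu, h⟩ := (mem_nhdsLT_iff_exists_Ioo_subset).1 h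
  obtain ⟨q, hq, hq'⟩ := exists_between (max_lt hu hab)
  exact ⟨q, ⟨(le_max_right _ _).trans_lt hq, hq'⟩,
    Filter.mem_of_superset (Ioo_mem_nhds ((le_max_left _ _).trans_lt hq) hq') h⟩

theorem RightAff.eventually_eq {f : ℝ → ℝ} {a : ℝ} (h : RightAff f a 1) (ha : f a = a) :
    ∀ᶠ t in 𝓝[>] a, f t = t := by
  filter_upwards [h.filter_mono (nhdsWithin_mono a Ioi_subset_Ici_self)] with t ht
  rw [ht, ha]; ring

/-- An affine germ commuting with an expansion extends to its whole domain of linearity. -/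
theorem affine_of_commute_expansion {f g : ℝ → ℝ} {a η k s : ℝ} (hcomm : ∀ t, f (g t) = g (f t))
    (hk : 1 < k) (hs : 0 < s) (hsk : s ≤ k)
    (hf : ∀ u ∈ Icc a (a + η), f u = a + k * (u - a))
    (hg : ∃ ε > 0, ∀ u ∈ Ico a (a + ε), g u = a + s * (u - a)) :
    ∀ u ∈ Icc a (a + η), g u = a + s * (u - a) := by
  obtain ⟨ε, hε, hg⟩ := hg
  have hk0 : 0 < k := by linarith
  have key : ∀ n : ℕ, ∀ u ∈ Icc a (a + η), u - a < k ^ n * ε → g u = a + s * (u - a) := by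
    intro n
    induction n with
    | zero => exact fun u hu h => hg u ⟨hu.1, by linarith⟩
    | succ n ih =>
      intro u hu h
      set v := a + (u - a) / k with hv
      have e : k * (v - a) = u - a := by rw [hv]; field_simp; ring
      have hv0 : 0 ≤ v - a := by
        rw [hv, add_sub_cancel_left]; exact div_nonneg (sub_nonneg.2 hu.1) hk0.le
      have hvu : v - a ≤ u - a := by nlinarith
      have hvI : v ∈ Icc a (a + η) := ⟨by linarith, by linarith [hu.2]⟩
      have h1 := ih v hvI (by
        rw [pow_succ] at h
        by_contra! h2
        nlinarith)
      have h2 : f v = u := by rw [hf v hvI, e]; ring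
      have h3 : s * (v - a) ≤ u - a := by rw [← e]; exact mul_le_mul_of_nonneg_right hsk hv0
      have h4 : 0 ≤ s * (v - a) := mul_nonneg hs.le hv0
      rw [← h2, ← hcomm, h1, hf _ ⟨by linarith, by linarith [hu.2]⟩, h2, ← e]
      ring
  intro u hu
  obtain ⟨n, hn⟩ := pow_unbounded_of_one_lt ((u - a) / ε) hk
  exact key n u hu ((div_lt_iff₀ hε).1 hn)

/-- The slopes at `c` of the elements of the centralizer of `x` do not accumulate at `1`
when `c` is an end point of a component of the support of `x`. -/
theorem exists_slope_gap_of_lt (hx : x ∈ PLGroup r L A hL) {c d : ℝ} (hcd : c < d) (hc : x c = c)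
    (hd : x d = d) (h : ∀ t ∈ Ioo c d, t < x t) :
    ∃ δ > 0, ∀ z ∈ PLGroup r L A hL, Commute x z → z c = c → z d = d → ∀ s, RightAff z c s →
      1 < s → 1 + δ ≤ s := by
  have hxmono := strictMono_of_mem hx
  have hxI := mem_Ioo_iff_of_fixed hxmono hc hd
  obtain ⟨k, hkL, hk⟩ := (hx.2 c).right
  obtain ⟨ε, hε, hk⟩ := hk.affOn_near
  rw [hc] at hk
  obtain ⟨η, hη, hη'⟩ := exists_between (lt_min hε (sub_pos.2 hcd))
  have hηε := hη'.trans_le (min_le_left _ _)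
  have hηd := hη'.trans_le (min_le_right _ _)
  have hk1 : 1 < k := by
    have h1 := h (c + η) ⟨by linarith, by linarith⟩
    rw [hk _ ⟨by linarith, by linarith⟩] at h1
    by_contra! h2
    nlinarith
  have hx' := inv_mem hx
  have hd' : x⁻¹ d = d := Equiv.Perm.inv_eq_iff_eq.2 hd.symm
  have hc' : x⁻¹ c = c := Equiv.Perm.inv_eq_iff_eq.2 hc.symm
  have h' : ∀ t ∈ Ioo c d, x⁻¹ t < t := fun t ht => by
    have := h _ ((mem_Ioo_iff_of_fixed (strictMono_of_mem hx') hc' hd' t).2 ht)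
    simpa using this
  obtain ⟨l, hlL, hl⟩ := (hx'.2 d).left
  obtain ⟨ε', hε', hl⟩ := hl.affOn_near
  rw [hd'] at hl
  obtain ⟨θ, hθ, hθ'⟩ := exists_between (lt_min hε' (sub_pos.2 hcd))
  have hθε := hθ'.trans_le (min_le_left _ _)
  have hθd := hθ'.trans_le (min_le_right _ _)
  have hl1 : 1 < l := by
    have h1 := h' (d - θ) ⟨by linarith, by linarith⟩
    rw [hl _ ⟨by linarith, by linarith⟩] at h1
    by_contra! h2
    nlinarith
  have ht₀ : c + η / 2 ∈ Ioo c d := ⟨by linarith, by linarith⟩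
  obtain ⟨_, ⟨n, rfl⟩, hn⟩ := exists_orbit_gt (continuous_of_mem hx) h
    (S := range fun n : ℕ => (x ^ n) (c + η / 2)) (u := d - θ) (by
      rintro _ ⟨n, rfl⟩
      induction n with
      | zero => simpa using ht₀
      | succ n ih => simp only [pow_succ', Equiv.Perm.mul_apply]; exact (hxI _).2 ih)
    (range_nonempty _) (by
      rintro _ ⟨n, rfl⟩
      exact ⟨n + 1, by simp only [pow_succ', Equiv.Perm.mul_apply]⟩) (by linarith)
  simp only at hn
  set X := x ^ n with hX
  set t₀ := c + η / 2 with ht₀'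
  have hXmem : X ∈ PLGroup r L A hL := pow_mem hx n
  have hXmono := strictMono_of_mem hXmem
  have hXd : X d = d := Equiv.Perm.pow_apply_eq_self_of_apply_eq_self hd n
  obtain ⟨m, hmL, hm⟩ := (hXmem.2 t₀).right
  have hm0 := hL.1 m hmL
  obtain ⟨ε₂, hε₂, hm⟩ := hm.affOn_near
  set t₁ := t₀ + min (ε₂ / 2) (η / 2) with ht₁
  have hmin0 : 0 < min (ε₂ / 2) (η / 2) := lt_min (by linarith) (by linarith)
  have hmin1 := min_le_left (ε₂ / 2) (η / 2)
  have hmin2 := min_le_right (ε₂ / 2) (η / 2)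
  refine ⟨min (k - 1) (ε₂ / (2 * η)), lt_min (by linarith) (by positivity), ?_⟩
  intro z hz hxz hzc hzd s hs hs1
  by_contra! hcon
  have hsk : s ≤ k := by linarith [min_le_left (k - 1) (ε₂ / (2 * η))]
  have hsε : (s - 1) * η < ε₂ / 2 := by
    have : s - 1 < ε₂ / (2 * η) := by linarith [min_le_right (k - 1) (ε₂ / (2 * η))]
    rw [lt_div_iff₀ (by linarith)] at this
    linarith
  obtain ⟨ε₃, hε₃, hs⟩ := hs.affOn_near
  rw [hzc] at hs
  have hzlin := affine_of_commute_expansion (f := x) (g := z) (a := c) (η := η) hxz.perm_apply hk1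
    (by linarith) hsk (fun u hu => hk u ⟨hu.1, by linarith [hu.2]⟩) ⟨ε₃, hε₃, hs⟩
  have hz₀ := hzlin t₀ ⟨by linarith, by linarith⟩
  have hz₁ := hzlin t₁ ⟨by linarith, by linarith⟩
  have hz₀' : t₀ < z t₀ := by rw [hz₀]; nlinarith
  have hzgt : ∀ t ∈ Ioo c d, t < z t := by
    rcases lt_or_gt_of_no_fixed (continuous_of_mem hz) (c := c) (d := d) (fun t ht hzt =>
      hz₀'.ne' (eq_of_fixed hx hz hxz hc hd (fun t ht => (h t ht).ne') ht hzt t₀ ht₀)) with h1 | h1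
    · exact absurd (h1 t₀ ht₀) hz₀'.not_gt
    · exact h1
  obtain ⟨q, hqL, hq⟩ := (hz.2 d).left
  obtain ⟨ε₄, hε₄, hq⟩ := hq.affOn_near
  rw [hzd] at hq
  have hq1 : q < 1 := by
    obtain ⟨u, hu, hu'⟩ := exists_between (show max c (d - ε₄) < d from max_lt hcd (by linarith))
    have h1 := hzgt u ⟨(le_max_left _ _).trans_lt hu, hu'⟩
    rw [hq u ⟨(le_max_right _ _).trans_lt hu, hu'.le⟩] at h1
    by_contra! h2
    nlinarith
  have hxz' : Commute x⁻¹ z := hxz.inv_left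
  have hzlin' := affine_of_commute_expansion (f := fun t => -(x⁻¹ (-t))) (g := fun t => -(z (-t)))
    (a := -d) (η := θ) (k := l) (s := q) (fun t => by simp only [neg_neg, hxz'.perm_apply]) hl1
    (hL.1 q hqL) (by linarith)
    (fun u hu => by
      rw [hl (-u) ⟨by linarith [hu.2], by linarith [hu.1]⟩]; ring)
    ⟨ε₄, hε₄, fun u hu => by
      rw [hq (-u) ⟨by linarith [hu.2], by linarith [hu.1]⟩]; ring⟩
  have hzlin'' : ∀ u ∈ Icc (d - θ) d, z u = d + q * (u - d) := fun u hu => by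
    have := hzlin' (-u) ⟨by linarith [hu.2], by linarith [hu.1]⟩
    simp only [neg_neg] at this
    linarith
  have hXz : Commute X z := hxz.pow_left n
  have key : ∀ t ∈ Icc t₀ t₁, m * (s - 1) * (t - c) = (1 - q) * (d - X t) := by
    intro t ht
    have hzt := hzlin t ⟨by linarith [ht.1], by linarith [ht.2]⟩
    have htd : t < d := by linarith [ht.2]
    have g1 : 0 ≤ (s - 1) * (t - c) := mul_nonneg (by linarith) (by linarith [ht.1])
    have g2 : (s - 1) * (t - c) ≤ (s - 1) * η :=
      mul_le_mul_of_nonneg_left (by linarith [ht.2]) (by linarith)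
    have h1 : X (z t) = X t₀ + m * (z t - t₀) := by
      refine hm _ ⟨?_, ?_⟩
      · rw [hzt]; linarith [ht.1]
      · rw [hzt]; linarith [ht.2]
    have h2 : X t = X t₀ + m * (t - t₀) := hm _ ⟨ht.1, by linarith [ht.2]⟩
    have h3 : z (X t) = d + q * (X t - d) := by
      refine hzlin'' _ ⟨?_, ?_⟩
      · linarith [hXmono.monotone ht.1]
      · rw [← hXd]; exact (hXmono htd).le.trans (by rw [hXd])
    rw [hXz.perm_apply, h3, hzt] at h1
    linear_combination (-1 : ℝ) * h1 + h2
  have k₀ := key t₀ ⟨le_rfl, by linarith⟩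
  have k₁ := key t₁ ⟨by linarith, le_rfl⟩
  have hX01 : X t₀ < X t₁ := hXmono (by linarith)
  have hms : 0 < m * (s - 1) := mul_pos hm0 (by linarith)
  have e1 : m * (s - 1) * (t₀ - c) < m * (s - 1) * (t₁ - c) :=
    mul_lt_mul_of_pos_left (by linarith) hms
  have e2 : (1 - q) * (d - X t₁) < (1 - q) * (d - X t₀) :=
    mul_lt_mul_of_pos_left (by linarith) (by linarith)
  linarith

theorem exists_slope_gap (hx : x ∈ PLGroup r L A hL) {c d : ℝ} (hcd : c < d) (hc : x c = c)
    (hd : x d = d) (h : ∀ t ∈ Ioo c d, x t ≠ t) :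
    ∃ δ > 0, ∀ z ∈ PLGroup r L A hL, Commute x z → z c = c → z d = d → ∀ s, RightAff z c s →
      1 < s → 1 + δ ≤ s := by
  rcases lt_or_gt_of_no_fixed (continuous_of_mem hx) h with h' | h'
  · have hx' := inv_mem hx
    have hd' : x⁻¹ d = d := Equiv.Perm.inv_eq_iff_eq.2 hd.symm
    have hc' : x⁻¹ c = c := Equiv.Perm.inv_eq_iff_eq.2 hc.symm
    obtain ⟨δ, hδ, h1⟩ := exists_slope_gap_of_lt hx' hcd hc' hd' fun t ht => by
      have := h' _ ((mem_Ioo_iff_of_fixed (strictMono_of_mem hx') hc' hd' t).2 ht)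
      simpa using this
    exact ⟨δ, hδ, fun z hz hxz => h1 z hz hxz.inv_left⟩
  · exact exists_slope_gap_of_lt hx hcd hc hd h'

theorem RightAff.inv {a k : ℝ} (hk : 0 < k) (hfa : f a = a) (h : RightAff f a k) :
    RightAff (f⁻¹ : Equiv.Perm ℝ) a k⁻¹ := by
  have := affine_symm (s' := Ici a) hk (fun t ht => ?_) h
  · rwa [hfa] at this
  · rw [hfa]
    have := mul_nonneg (inv_pos.2 hk).le (sub_nonneg.2 ht)
    simp only [mem_Ici]; linarith

theorem RightAff.mul {a k l : ℝ} (hl : 0 < l) (hga : g a = a) (hf : RightAff f a k)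
    (hg : RightAff g a l) : RightAff (f * g : Equiv.Perm ℝ) a (k * l) :=
  RightAff.comp (f := f) (g := g) hl (by rwa [hga]) hg

theorem RightAff.zpow {a k : ℝ} (hk : 0 < k) (hfa : f a = a) (h : RightAff f a k) (n : ℤ) :
    RightAff (f ^ n : Equiv.Perm ℝ) a (k ^ n) := by
  have key : ∀ n : ℕ, RightAff (f ^ n : Equiv.Perm ℝ) a (k ^ n) := by
    intro n
    induction n with
    | zero => exact Eventually.of_forall fun t => by simp
    | succ n ih => rw [pow_succ, pow_succ]; exact ih.mul hk hfa h
  cases n with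
  | ofNat n => simpa using key n
  | negSucc n =>
    rw [zpow_negSucc, zpow_negSucc]
    exact (key _).inv (by positivity) (Equiv.Perm.pow_apply_eq_self_of_apply_eq_self hfa _)

/-- A group of germs at `a` that embeds into the slopes, with slopes not accumulating at `1`,
is cyclic. -/
theorem exists_generator {K : Subgroup (Equiv.Perm ℝ)} {a δ : ℝ} (hδ : 0 < δ)
    (hK : ∀ z ∈ K, z a = a) (hslope : ∀ z ∈ K, ∃ s > 0, RightAff z a s)
    (hgap : ∀ z ∈ K, ∀ s, RightAff z a s → 1 < s → 1 + δ ≤ s)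
    (hinj : ∀ z ∈ K, RightAff z a 1 → z = 1) :
    ∃ w ∈ K, ∀ z ∈ K, ∃ n : ℤ, w ^ n = z := by
  let T : AddSubgroup ℝ :=
    { carrier := {u | ∃ z ∈ K, RightAff z a (Real.exp u)}
      zero_mem' := ⟨1, one_mem K, Eventually.of_forall fun t => by simp⟩
      add_mem' := by
        rintro u v ⟨z, hz, hzu⟩ ⟨w, hw, hwv⟩
        refine ⟨z * w, mul_mem hz hw, ?_⟩
        rw [Real.exp_add]
        exact hzu.mul (Real.exp_pos v) (hK w hw) hwv
      neg_mem' := by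
        rintro u ⟨z, hz, hzu⟩
        refine ⟨z⁻¹, inv_mem hz, ?_⟩
        rw [Real.exp_neg]
        exact hzu.inv (Real.exp_pos u) (hK z hz) }
  obtain ⟨g, hg⟩ := AddSubgroup.cyclic_of_isolated_zero (H := T)
    (Real.log_pos (show 1 < 1 + δ by linarith)) (by
      rw [Set.disjoint_left]
      rintro u ⟨z, hz, hzu⟩ ⟨hu0, hu⟩
      have h1 := hgap z hz _ hzu (Real.one_lt_exp_iff.2 hu0)
      exact ((Real.log_le_iff_le_exp (by linarith)).2 h1).not_gt hu)
  have hgT : g ∈ T := by rw [hg]; exact AddSubgroup.mem_closure_singleton_self g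
  obtain ⟨w, hw, hwg⟩ := hgT
  refine ⟨w, hw, fun z hz => ?_⟩
  obtain ⟨s, hs, hzs⟩ := hslope z hz
  have hsT : Real.log s ∈ T := ⟨z, hz, by rwa [Real.exp_log hs]⟩
  rw [hg, AddSubgroup.mem_closure_singleton] at hsT
  obtain ⟨n, hn⟩ := hsT
  have hsn : s = Real.exp g ^ n := by
    rw [← Real.rpow_intCast, ← Real.exp_mul, mul_comm, ← zsmul_eq_mul, hn, Real.exp_log hs]
  refine ⟨n, ?_⟩
  have h1 := (hwg.zpow (Real.exp_pos g) (hK w hw) n)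
  rw [← hsn] at h1
  have h2 := h1.mul (inv_pos.2 hs) (hK _ (inv_mem hz)) (hzs.inv hs (hK z hz))
  rw [mul_inv_cancel₀ hs.ne'] at h2
  exact mul_inv_eq_one.1 (hinj _ (mul_mem (zpow_mem hw n) (inv_mem hz)) h2)

theorem eventually_not_fixBdry (hf : f ∈ PLGroup r L A hL) (p : ℝ) :
    ∀ᶠ t in 𝓝[≠] p, ¬ FixBdry f t := by
  by_cases hp : f p = p
  swap
  · have : ∀ᶠ t in 𝓝 p, f t ≠ t :=
      (isClosed_eq (continuous_of_mem hf) continuous_id).isOpen_compl.mem_nhds hp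
    exact (this.filter_mono nhdsWithin_le_nhds).mono fun t ht h => ht h.1
  have key : ∀ k t : ℝ, t ≠ p → (∀ᶠ s in 𝓝 t, f s = p + k * (s - p)) → ¬ FixBdry f t := by
    rintro k t htp h ⟨h1, h2⟩
    have h3 := h.self_of_nhds
    rw [h1] at h3
    have hk : k = 1 := by
      have : (k - 1) * (t - p) = 0 := by linear_combination -h3
      rcases mul_eq_zero.1 this with h' | h'
      · linarith
      · exact absurd (sub_eq_zero.1 h') htp
    subst hk
    exact h2 (h.mono fun s hs => by rw [hs]; ring)
  obtain ⟨k, -, hk⟩ := (hf.2 p).right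
  obtain ⟨ε, hε, hk⟩ := hk.affOn_near
  obtain ⟨l, -, hl⟩ := (hf.2 p).left
  obtain ⟨ε', hε', hl⟩ := hl.affOn_near
  rw [hp] at hk hl
  filter_upwards [self_mem_nhdsWithin, nhdsWithin_le_nhds (Ioo_mem_nhds
    (show p - ε' < p by linarith) (show p < p + ε by linarith))] with t htp ht
  rcases lt_or_gt_of_ne (show t ≠ p from htp) with h | h
  · exact key l t htp (Filter.mem_of_superset (Ioo_mem_nhds ht.1 h)
      fun s hs => hl s ⟨hs.1, hs.2.le⟩)
  · exact key k t htp (Filter.mem_of_superset (Ioo_mem_nhds h ht.2)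
      fun s hs => hk s ⟨hs.1.le, hs.2⟩)

theorem FixBdry.mem_Icc (hf : f ∈ PLGroup r L A hL) {p : ℝ} (hp : FixBdry f p) :
    p ∈ Icc 0 r := by
  by_contra h
  refine hp.2 (Filter.mem_of_superset (isClosed_Icc.isOpen_compl.mem_nhds h) fun t ht => ?_)
  exact apply_eq_of_notMem_Ioo hf fun h' => ht (Ioo_subset_Icc_self h')

theorem finite_fixBdry (hf : f ∈ PLGroup r L A hL) : {p | FixBdry f p}.Finite := by
  by_contra h
  obtain ⟨p, -, hp⟩ := Set.Infinite.exists_accPt_of_subset_isCompact h isCompact_Icc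
    fun p hp => FixBdry.mem_Icc hf hp
  exact accPt_iff_frequently_nhdsNE.1 hp (eventually_not_fixBdry hf p)

theorem StrictMono.apply_eq_of_finite {α : Type*} [LinearOrder α] {f : α → α} (hf : StrictMono f)
    {S : Set α} (hS : S.Finite) (hfS : ∀ s ∈ S, f s ∈ S) {s : α} (hs : s ∈ S) : f s = s := by
  have hmem : ∀ n, f^[n] s ∈ S := by
    intro n
    induction n with
    | zero => exact hs
    | succ n ih => rw [Function.iterate_succ_apply']; exact hfS _ ih
  rcases lt_trichotomy (f s) s with h | h | h
  · exact absurd hS (Set.infinite_of_injective_forall_mem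
      (hf.strictAnti_iterate_of_map_lt h).injective hmem)
  · exact h
  · exact absurd hS (Set.infinite_of_injective_forall_mem
      (hf.strictMono_iterate_of_lt_map h).injective hmem)

theorem FixBdry.apply_eq (hx : x ∈ PLGroup r L A hL) (hz : z ∈ PLGroup r L A hL)
    (hxz : Commute x z) {p : ℝ} (hp : FixBdry x p) : z p = p := by
  refine (strictMono_of_mem hz).apply_eq_of_finite (finite_fixBdry hx) (fun q hq => ⟨?_, ?_⟩) hp
  · rw [hxz.perm_apply, hq.1]
  · refine fun h => hq.2 (((continuous_of_mem hz).continuousAt.eventually h).mono fun t ht => ?_)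
    rw [hxz.perm_apply] at ht
    exact z.injective ht

theorem exists_slope_gap_of_germ_ne (hx : x ∈ PLGroup r L A hL) {a : ℝ} (hxa : x a = a)
    (hne : ¬ ∀ᶠ t in 𝓝[>] a, x t = t) :
    ∃ δ > 0, ∀ z ∈ PLGroup r L A hL, Commute x z → z a = a → ∀ s, RightAff z a s →
      1 < s → 1 + δ ≤ s := by
  obtain ⟨k, -, hk⟩ := (hx.2 a).right
  have hk1 : k ≠ 1 := by
    rintro rfl
    exact hne (hk.eventually_eq hxa)
  obtain ⟨ε, hε, hk⟩ := hk.affOn_near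
  rw [hxa] at hk
  have hfix : ∀ t ∈ Ioo a (a + ε), x t ≠ t := by
    intro t ht h
    rw [hk t ⟨ht.1.le, ht.2⟩] at h
    have : (k - 1) * (t - a) = 0 := by linear_combination h
    rcases mul_eq_zero.1 this with h' | h'
    · exact hk1 (by linarith)
    · linarith [ht.1]
  obtain ⟨c, d, hct, htd, hc, hd, hcd⟩ := exists_component hx
    (hfix (a + ε / 2) ⟨by linarith, by linarith⟩)
  have hca : c = a := by
    rcases lt_trichotomy c a with h | h | h
    · exact absurd hxa (hcd a ⟨h, by linarith⟩)
    · exact h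
    · exact absurd hc (hfix c ⟨h, by linarith⟩)
  subst hca
  have hcd' : c < d := hct.trans htd
  obtain ⟨δ, hδ, h⟩ := exists_slope_gap hx hcd' hc hd hcd
  refine ⟨δ, hδ, fun z hz hxz hzc => h z hz hxz hzc ?_⟩
  refine FixBdry.apply_eq hx hz hxz ⟨hd, fun h' => ?_⟩
  obtain ⟨q, hq, hq'⟩ := exists_locId_left hcd' (h'.filter_mono nhdsWithin_le_nhds)
  exact hcd q hq hq'.eq

theorem commute_of_irredOn {w v : Equiv.Perm ℝ} (hx : x ∈ PLGroup r L A hL)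
    (hw : w ∈ PLGroup r L A hL) (hv : v ∈ PLGroup r L A hL) {a b : ℝ} (hab : a < b)
    (hxa : x a = a) (hxb : x b = b) (hirr : IrredOn A w w a b) (hxw : Commute x w)
    (hwv : Commute w v) (hv' : ∀ t ∉ Ioo a b, v t = t) : Commute x v := by
  have hva : v a = a := hv' a fun h => h.1.false
  obtain ⟨k, hkL, hk⟩ := (hx.2 a).right
  obtain ⟨s, hsL, hs⟩ := (hv.2 a).right
  have hk0 := hL.1 k hkL
  have hs0 := hL.1 s hsL
  have hx' := hk.inv hk0 hxa
  have hxa' : x⁻¹ a = a := Equiv.Perm.inv_eq_iff_eq.2 hxa.symm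
  have hva' : v⁻¹ a = a := Equiv.Perm.inv_eq_iff_eq.2 hva.symm
  have h1 : RightAff (x * (v * (x⁻¹ * v⁻¹)) : Equiv.Perm ℝ) a (k * (s * (k⁻¹ * s⁻¹))) :=
    hk.mul (by positivity) (by simp only [Equiv.Perm.mul_apply, hxa', hva', hva])
      (hs.mul (by positivity) (by simp only [Equiv.Perm.mul_apply, hxa', hva'])
        (hx'.mul (by positivity) hva' (hs.inv hs0 hva)))
  rw [show k * (s * (k⁻¹ * s⁻¹)) = 1 by field_simp] at h1
  set u := x * (v * (x⁻¹ * v⁻¹)) with hu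
  have hua : u a = a := by simp only [hu, Equiv.Perm.mul_apply, hxa', hva', hva, hxa]
  have humem : u ∈ PLGroup r L A hL :=
    mul_mem hx (mul_mem hv (mul_mem (inv_mem hx) (inv_mem hv)))
  have hwu : Commute w u := hxw.symm.mul_right
    (hwv.mul_right (hxw.symm.inv_right.mul_right hwv.inv_right))
  obtain ⟨q, hq, hq'⟩ := exists_locId_right hab (h1.eventually_eq hua)
  have hin := hirr.eq_id hw hw humem hwu hwu hq hq'
  have hxI := mem_Ioo_iff_of_fixed (strictMono_of_mem hx) hxa hxb
  have hu1 : u = 1 := by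
    ext t
    by_cases ht : t ∈ Ioo a b
    · exact hin t ht
    · have e1 : v⁻¹ t = t := Equiv.Perm.inv_eq_iff_eq.2 (hv' t ht).symm
      have e2 : x⁻¹ t ∉ Ioo a b := fun h => ht (by simpa using (hxI _).2 h)
      simp only [hu, Equiv.Perm.mul_apply, e1, hv' _ e2]
      simp
  have : x * v * (v * x)⁻¹ = 1 := by rw [← hu1, hu]; group
  exact mul_inv_eq_one.1 this

/-- On an irreducible interval the centralizer of a pair is trivial, or infinite cyclic and
equal to the centralizer of its generator. -/
theorem centralizer_irredOn (hx : x ∈ PLGroup r L A hL) (hy : y ∈ PLGroup r L A hL) {a b : ℝ}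
    (hab : a < b) (hirr : IrredOn A x y a b) {K : Subgroup (Equiv.Perm ℝ)}
    (hK : ∀ z, z ∈ K ↔ (z ∈ PLGroup r L A hL ∧ ∀ t ∉ Ioo a b, z t = t) ∧
      Commute x z ∧ Commute y z) :
    (∀ z ∈ K, z = 1) ∨ ∃ w ∈ K, (∀ v ∈ PLGroup r L A hL, (∀ t ∉ Ioo a b, v t = t) →
      Commute w v → v ∈ K) ∧ ∀ z ∈ K, ∃ n : ℤ, w ^ n = z := by
  have hKa : ∀ z ∈ K, z a = a := fun z hz => ((hK z).1 hz).1.2 a fun h => h.1.false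
  have hKb : ∀ z ∈ K, z b = b := fun z hz => ((hK z).1 hz).1.2 b fun h => h.2.false
  have hone : ∀ z ∈ K, (∃ q ∈ Ioo a b, LocId z q) → z = 1 := by
    rintro z hz ⟨q, hq, hzq⟩
    obtain ⟨⟨h1, h2⟩, h3, h4⟩ := (hK z).1 hz
    ext t
    by_cases ht : t ∈ Ioo a b
    · exact hirr.eq_id hx hy h1 h3 h4 hq hzq t ht
    · exact h2 t ht
  by_cases hfix : x a = a ∧ x b = b ∧ y a = a ∧ y b = b
  swap
  · refine Or.inl fun z hz => hone z hz ?_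
    obtain ⟨⟨h1, h2⟩, h3, h4⟩ := (hK z).1 hz
    have ha : x a ≠ a ∨ y a ≠ a → ∃ q ∈ Ioo a b, LocId z q := fun h => by
      refine exists_locId_right hab (Filter.Eventually.filter_mono nhdsWithin_le_nhds ?_)
      exact h.elim (locId_of_fixed hx h1 h3 (hKa z hz)) (locId_of_fixed hy h1 h4 (hKa z hz))
    have hb : x b ≠ b ∨ y b ≠ b → ∃ q ∈ Ioo a b, LocId z q := fun h => by
      refine exists_locId_left hab (Filter.Eventually.filter_mono nhdsWithin_le_nhds ?_)
      exact h.elim (locId_of_fixed hx h1 h3 (hKb z hz)) (locId_of_fixed hy h1 h4 (hKb z hz))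
    tauto
  obtain ⟨hxa, hxb, hya, hyb⟩ := hfix
  obtain ⟨δ, hδ, hgap⟩ : ∃ δ > 0, ∀ z ∈ K, ∀ s, RightAff z a s → 1 < s → 1 + δ ≤ s := by
    by_cases hxne : ∀ᶠ t in 𝓝[>] a, x t = t
    · by_cases hyne : ∀ᶠ t in 𝓝[>] a, y t = t
      · obtain ⟨u, hu, hu'⟩ := mem_nhdsGT_iff_exists_Ioo_subset.1 (hxne.and hyne)
        obtain ⟨q, hq, hq'⟩ := exists_between (lt_min hu hab)
        have hmem : Ioo a u ∈ 𝓝 q := Ioo_mem_nhds hq (hq'.trans_le (min_le_left _ _))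
        exact absurd ⟨Filter.mem_of_superset hmem fun t ht => (hu' ht).1,
          Filter.mem_of_superset hmem fun t ht => (hu' ht).2⟩
          (hirr q ⟨hq, hq'.trans_le (min_le_right _ _)⟩).1
      · obtain ⟨δ, hδ, h⟩ := exists_slope_gap_of_germ_ne hy hya hyne
        exact ⟨δ, hδ, fun z hz => h z ((hK z).1 hz).1.1 ((hK z).1 hz).2.2 (hKa z hz)⟩
    · obtain ⟨δ, hδ, h⟩ := exists_slope_gap_of_germ_ne hx hxa hxne
      exact ⟨δ, hδ, fun z hz => h z ((hK z).1 hz).1.1 ((hK z).1 hz).2.1 (hKa z hz)⟩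
  obtain ⟨w, hw, hgen⟩ := exists_generator hδ hKa (fun z hz => by
    obtain ⟨s, hs, h⟩ := (((hK z).1 hz).1.1.2 a).right
    exact ⟨s, hL.1 s hs, h⟩) hgap
    fun z hz h => hone z hz (exists_locId_right hab (h.eventually_eq (hKa z hz)))
  by_cases hw1 : w = 1
  · refine Or.inl fun z hz => ?_
    obtain ⟨n, rfl⟩ := hgen z hz
    rw [hw1, one_zpow]
  refine Or.inr ⟨w, hw, fun v hv hv' hwv => ?_, hgen⟩
  obtain ⟨⟨hwm, hw'⟩, hxw, hyw⟩ := (hK w).1 hw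
  have hirr' : IrredOn A w w a b := by
    have h1 : ∀ p ∈ Ioo a b, ¬ LocId w p := fun p hp h => hw1 (hone w hw ⟨p, hp, h⟩)
    refine fun p hp => ⟨fun h => h1 p hp h.1, fun hpA => (and_self_iff).2 fun h => ?_⟩
    obtain ⟨h2, h3⟩ := hirr p hp
    have h4 := h3 hpA
    by_cases hxp : x p = p
    · by_cases hyp : y p = p
      · simp only [FixBdry, hxp, hyp, true_and, not_not] at h4
        exact h2 h4
      · exact h1 p hp (locId_of_fixed hy hwm hyw h.1 hyp)
    · exact h1 p hp (locId_of_fixed hx hwm hxw h.1 hxp)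
  exact (hK v).2 ⟨⟨hv, hv'⟩, commute_of_irredOn hx hwm hv hab hxa hxb hirr' hxw hwv hv',
    commute_of_irredOn hy hwm hv hab hya hyb hirr' hyw hwv hv'⟩

/-- A finite set of reals cuts the interval between two of its points into intervals. -/
theorem exists_partition {E : Set ℝ} (hE : E.Finite) {b : ℝ} (hb : b ∈ E) {a : ℝ} (ha : a ∈ E)
    (hab : a ≤ b) :
    ∃ (n : ℕ) (αs : ℕ → ℝ), αs 0 = a ∧ αs n = b ∧ (∀ i < n, αs i < αs (i + 1)) ∧
      (∀ i ≤ n, αs i ∈ E) ∧ ∀ i < n, ∀ e ∈ Ioo (αs i) (αs (i + 1)), e ∉ E := by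
  induction hm : (E ∩ Ioc a b).ncard using Nat.strong_induction_on generalizing a with
  | _ m ih =>
  rcases hab.eq_or_lt with rfl | hab
  · exact ⟨0, fun _ => a, rfl, rfl, by simp, fun _ _ => ha, by simp⟩
  obtain ⟨c, ⟨hcE, hac, hcb⟩, hc⟩ := Set.exists_min_image (E ∩ Ioc a b) id (hE.inter_of_left _)
    ⟨b, hb, hab, le_rfl⟩
  have hlt : (E ∩ Ioc c b).ncard < m := by
    rw [← hm]
    refine Set.ncard_lt_ncard ⟨inter_subset_inter_right _ (Ioc_subset_Ioc_left hac.le), fun h => ?_⟩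
      (hE.inter_of_left _)
    exact (h ⟨hcE, hac, hcb⟩).2.1.false
  obtain ⟨n, αs, h0, hn, hlt', hmem, hE'⟩ := ih _ hlt hcE hcb rfl
  refine ⟨n + 1, fun i => Nat.casesOn i a αs, rfl, hn, ?_, ?_, ?_⟩
  · rintro (_ | i) hi
    · simpa [h0] using hac
    · exact hlt' i (by lia)
  · rintro (_ | i) hi
    · exact ha
    · exact hmem i (by lia)
  · rintro (_ | i) hi e he heE
    · simp only [h0] at he
      exact (hc e ⟨heE, he.1, he.2.le.trans hcb⟩).not_gt he.2
    · exact hE' i (by lia) e he heE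

section Partition

variable {n : ℕ} {αs : ℕ → ℝ}

theorem partition_le (h : ∀ i < n, αs i < αs (i + 1)) {i j : ℕ} (hij : i ≤ j) (hj : j ≤ n) :
    αs i ≤ αs j := by
  induction j, hij using Nat.le_induction with
  | base => exact le_rfl
  | succ j hij ih => exact (ih (by lia)).trans (h j (by lia)).le

theorem partition_disjoint (h : ∀ i < n, αs i < αs (i + 1)) :
    Pairwise fun i j : Fin n => Disjoint (Ioo (αs i) (αs (i + 1))) (Ioo (αs j) (αs (j + 1))) := by
  have key : ∀ i j : Fin n, i < j →
      Disjoint (Ioo (αs i) (αs (i + 1))) (Ioo (αs j) (αs (j + 1))) := by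
    intro i j hij
    rw [Set.disjoint_left]
    intro t ht ht'
    have := partition_le h (show (i : ℕ) + 1 ≤ j from hij) j.2.le
    linarith [ht.2, ht'.1]
  intro i j hij
  rcases lt_or_gt_of_ne hij with h' | h'
  · exact key i j h'
  · exact (key j i h').symm

theorem partition_cover {t : ℝ} (h0 : αs 0 ≤ t) (hn : t ≤ αs n) :
    (∃ i < n, t ∈ Ioo (αs i) (αs (i + 1))) ∨ ∃ i ≤ n, t = αs i := by
  induction n with
  | zero => exact Or.inr ⟨0, le_rfl, le_antisymm hn h0⟩
  | succ n ih =>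
    rcases le_or_gt t (αs n) with h | h
    · rcases ih h with ⟨i, hi, h⟩ | ⟨i, hi, h⟩
      · exact Or.inl ⟨i, by lia, h⟩
      · exact Or.inr ⟨i, by lia, h⟩
    · rcases hn.eq_or_lt with h' | h'
      · exact Or.inr ⟨n + 1, le_rfl, h'⟩
      · exact Or.inl ⟨n, by lia, h, h'⟩

theorem apply_mem_of_fix_compl {α : Type*} {f : Equiv.Perm α} {S : Set α}
    (hf : ∀ t ∉ S, f t = t) {t : α} (ht : t ∈ S) : f t ∈ S := by
  by_contra h
  exact h (by rwa [f.injective (hf _ h)])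

theorem prod_apply_of_disjoint {α : Type*} {n : ℕ} {S : Fin n → Set α}
    (hS : Pairwise fun i j => Disjoint (S i) (S j)) {f : Fin n → Equiv.Perm α}
    (hf : ∀ i, ∀ t ∉ S i, f i t = t) :
    (∀ i, ∀ t ∈ S i, (List.ofFn f).prod t = f i t) ∧
      ∀ t, (∀ i, t ∉ S i) → (List.ofFn f).prod t = t := by
  induction n with
  | zero => exact ⟨fun i => i.elim0, fun t _ => by simp⟩
  | succ n ih =>
    obtain ⟨ih1, ih2⟩ := ih (S := fun i => S i.succ) (f := fun i => f i.succ)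
      (fun i j hij => hS fun h => hij (Fin.succ_injective _ h)) (fun i => hf i.succ)
    refine ⟨fun i t ht => ?_, fun t ht => ?_⟩
    · rw [List.ofFn_succ, List.prod_cons, Equiv.Perm.mul_apply]
      refine Fin.cases (fun ht => ?_) (fun i ht => ?_) i ht
      · rw [ih2 t fun j hj => Set.disjoint_left.1 (hS (Fin.succ_ne_zero j)) hj ht]
      · rw [ih1 i t ht]
        refine hf 0 _ fun h => ?_
        exact Set.disjoint_left.1 (hS (Fin.succ_ne_zero i)) (apply_mem_of_fix_compl (hf _) ht) h
    · rw [List.ofFn_succ, List.prod_cons, Equiv.Perm.mul_apply, ih2 t fun j => ht j.succ]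
      exact hf 0 t (ht 0)

theorem eq_prod_of_disjoint {α : Type*} {n : ℕ} {S : Fin n → Set α}
    (hS : Pairwise fun i j => Disjoint (S i) (S j)) {f : Fin n → Equiv.Perm α}
    (hf : ∀ i, ∀ t ∉ S i, f i t = t) {g : Equiv.Perm α} (h1 : ∀ i, ∀ t ∈ S i, g t = f i t)
    (h2 : ∀ t, (∀ i, t ∉ S i) → g t = t) : g = (List.ofFn f).prod := by
  obtain ⟨h3, h4⟩ := prod_apply_of_disjoint hS hf
  ext t
  by_cases ht : ∃ i, t ∈ S i
  · obtain ⟨i, hi⟩ := ht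
    rw [h1 i t hi, h3 i t hi]
  · push Not at ht
    rw [h2 t ht, h4 t ht]

theorem isInternalDirectProduct_iff (hαs : ∀ i < n, αs i < αs (i + 1))
    {H : Subgroup (Equiv.Perm ℝ)} {Hs : ℕ → Subgroup (Equiv.Perm ℝ)}
    (hHs : ∀ i < n, ∀ z ∈ Hs i, ∀ t ∉ Ioo (αs i) (αs (i + 1)), z t = t) :
    IsInternalDirectProduct H n Hs ↔ ∀ z, z ∈ H ↔
      (∀ t, (∀ i < n, t ∉ Ioo (αs i) (αs (i + 1))) → z t = t) ∧
      ∀ i < n, ∃ w ∈ Hs i, ∀ t ∈ Ioo (αs i) (αs (i + 1)), z t = w t := by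
  have hdisj := partition_disjoint hαs
  have hcomm : ∀ i < n, ∀ j < n, i ≠ j → ∀ x ∈ Hs i, ∀ y ∈ Hs j, Commute x y := by
    intro i hi j hj hij x hx y hy
    refine Equiv.Perm.Disjoint.commute fun t => ?_
    by_cases ht : t ∈ Ioo (αs i) (αs (i + 1))
    · refine Or.inr (hHs j hj y hy t fun ht' => ?_)
      exact Set.disjoint_left.1 (@hdisj ⟨i, hi⟩ ⟨j, hj⟩ (by simpa using hij)) ht ht'
    · exact Or.inl (hHs i hi x hx t ht)
  rw [IsInternalDirectProduct, and_iff_right hcomm]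
  refine forall_congr' fun z => iff_congr Iff.rfl ⟨?_, ?_⟩
  · rintro ⟨t, rfl, -⟩
    obtain ⟨h1, h2⟩ := prod_apply_of_disjoint hdisj fun i => hHs i i.2 _ (t i).2
    exact ⟨fun s hs => h2 s fun i => hs i i.2,
      fun i hi => ⟨t ⟨i, hi⟩, (t ⟨i, hi⟩).2, h1 ⟨i, hi⟩⟩⟩
  · rintro ⟨h1, h2⟩
    choose! w hw hzw using h2
    refine ⟨fun i => ⟨w i, hw i i.2⟩, ?_, fun t ht => ?_⟩
    · exact eq_prod_of_disjoint hdisj (fun i => hHs i i.2 _ (hw i i.2)) (fun i => hzw i i.2)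
        fun s hs => h1 s fun i hi => hs ⟨i, hi⟩
    · obtain ⟨h3, -⟩ := prod_apply_of_disjoint hdisj fun i => hHs i i.2 _ (t i).2
      funext i
      ext s
      by_cases hs : s ∈ Ioo (αs i) (αs (i + 1))
      · simp only
        rw [← h3 i s hs, ← ht, hzw i i.2 s hs]
      · simp only
        rw [hHs i i.2 _ (t i).2 s hs, hHs i i.2 _ (hw i i.2) s hs]

end Partition

theorem apply_eq_of_mem_uIcc (hx : x ∈ PLGroup r L A hL) (hz : z ∈ PLGroup r L A hL)
    (hxz : Commute x z) {p t : ℝ} (hp : z p = p) (hpt : p ∈ uIcc t (x t)) : z t = t := by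
  by_cases hxt : x t = t
  · rw [hxt, uIcc_self, mem_singleton_iff] at hpt
    rwa [← hpt]
  obtain ⟨c, d, hct, htd, hc, hd, h⟩ := exists_component hx hxt
  have hI := (mem_Ioo_iff_of_fixed (strictMono_of_mem hx) hc hd t).2 ⟨hct, htd⟩
  exact eq_of_fixed hx hz hxz hc hd h (ordConnected_Ioo.uIcc_subset ⟨hct, htd⟩ hI hpt) hp t
    ⟨hct, htd⟩

/-- Restricting an element of the centralizer of `x` between two of its fixed points gives an
element of the centralizer of `x`. -/
theorem commute_restrict (hx : x ∈ PLGroup r L A hL) (hz : z ∈ PLGroup r L A hL)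
    (hxz : Commute x z) {w : Equiv.Perm ℝ} {a b : ℝ} (hza : z a = a) (hzb : z b = b)
    (hw : ∀ t ∈ Ioo a b, w t = z t) (hw' : ∀ t ∉ Ioo a b, w t = t) : Commute x w := by
  have hsep : ∀ s t, s ∈ Ioo a b → t ∉ Ioo a b → ∃ p ∈ uIcc s t, z p = p := by
    intro s t hs ht
    rcases le_or_gt t a with h | h
    · exact ⟨a, mem_uIcc.2 (Or.inr ⟨h, hs.1.le⟩), hza⟩
    · exact ⟨b, mem_uIcc.2 (Or.inl ⟨hs.2.le, not_lt.1 fun h' => ht ⟨h, h'⟩⟩), hzb⟩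
  ext t
  simp only [Equiv.Perm.mul_apply]
  by_cases ht : t ∈ Ioo a b <;> by_cases hxt : x t ∈ Ioo a b
  · rw [hw t ht, hw _ hxt, hxz.perm_apply]
  · obtain ⟨p, hp, hzp⟩ := hsep _ _ ht hxt
    rw [hw t ht, hw' _ hxt, apply_eq_of_mem_uIcc hx hz hxz hzp hp]
  · obtain ⟨p, hp, hzp⟩ := hsep _ _ hxt ht
    rw [hw' t ht, hw _ hxt, ← hxz.perm_apply,
      apply_eq_of_mem_uIcc hx hz hxz hzp (by rwa [uIcc_comm])]
  · rw [hw' t ht, hw' _ hxt]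

theorem memFS_iff (hA : IsSlopeModule r L A) {S : Set ℝ} :
    memFS r L A S f ↔ f ∈ PLGroup r L A hL ∧ ∀ t ∉ S, f t = t := by
  rw [memFS, memF_iff hA (hL := hL)]
  refine and_congr_right fun _ => ⟨fun h t ht => ?_, fun h t ht => ?_⟩
  · by_contra hne
    exact ht (h hne)
  · by_contra hne
    exact ht (h t hne)

theorem ne_memFS_of_commute (hr : 0 < r) (hL : IsSlopeSubgroup L) (hLne : L ≠ {1})
    (hA : IsSlopeModule r L A) {a b : ℝ} (ha : a ∈ A) (hb : b ∈ A) (ha0 : 0 ≤ a) (hab : a < b)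
    (hbr : b ≤ r) {K : Set (Equiv.Perm ℝ)} (hK : ∀ f ∈ K, ∀ g ∈ K, Commute f g) :
    K ≠ {y | memFS r L A (Ioo a b) y} := by
  rintro rfl
  obtain ⟨f, hf, g, hg, hf', hg', hfg⟩ :=
    exists_not_commute (hL := hL) hr hLne hA ha hb ha0 hab hbr
  exact hfg (hK f ((memFS_iff hA).2 ⟨hf, hf'⟩) g ((memFS_iff hA).2 ⟨hg, hg'⟩))

theorem exists_decomposition (hr : 0 < r) (hL : IsSlopeSubgroup L) (hLne : L ≠ {1})
    (hA : IsSlopeModule r L A) (hx : x ∈ PLGroup r L A hL) (hy : y ∈ PLGroup r L A hL)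
    {H : Subgroup (Equiv.Perm ℝ)}
    (hH : ∀ z, z ∈ H ↔ z ∈ PLGroup r L A hL ∧ Commute x z ∧ Commute y z) :
    ∃ (n : ℕ) (αs : ℕ → ℝ) (Hs : ℕ → Subgroup (Equiv.Perm ℝ)),
      αs 0 = 0 ∧ αs n = r ∧ (∀ i < n, αs i < αs (i + 1)) ∧ (∀ i ≤ n, αs i ∈ A) ∧
      IsInternalDirectProduct H n Hs ∧
      (∀ i < n,
        ((Hs i : Set (Equiv.Perm ℝ)) = {(1 : Equiv.Perm ℝ)}) ∨
        ((Hs i : Set (Equiv.Perm ℝ)) =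
            {y : Equiv.Perm ℝ | memFS r L A (Ioo (αs i) (αs (i + 1))) y}) ∨
        (∃ x : Equiv.Perm ℝ, memFS r L A (Ioo (αs i) (αs (i + 1))) x ∧
          (Hs i : Set (Equiv.Perm ℝ)) =
            {y : Equiv.Perm ℝ |
              memFS r L A (Ioo (αs i) (αs (i + 1))) y ∧ Commute x y} ∧
          (Hs i : Set (Equiv.Perm ℝ)) = Set.range fun m : ℤ => x ^ m)) ∧
      (∀ i, i + 1 < n →
        (Hs i : Set (Equiv.Perm ℝ)) =
          {y : Equiv.Perm ℝ | memFS r L A (Ioo (αs i) (αs (i + 1))) y} →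
        (Hs (i + 1) : Set (Equiv.Perm ℝ)) ≠
          {y : Equiv.Perm ℝ | memFS r L A (Ioo (αs (i + 1)) (αs (i + 2))) y}) := by
  set E : Set ℝ := {p | (p = 0 ∨ p = r ∨ FixBdry x p ∨ FixBdry y p) ∧ p ∈ A} with hE
  have hEfin : E.Finite := by
    refine ((((finite_fixBdry hx).union (finite_fixBdry hy)).insert r).insert 0).subset ?_
    rintro p ⟨hp, -⟩
    exact hp
  obtain ⟨n, αs, h0, hn, hlt, hmem, hgap⟩ := exists_partition hEfin (a := 0) (b := r)
    ⟨Or.inr (Or.inl rfl), hA.1⟩ ⟨Or.inl rfl, hA.2.1⟩ hr.le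
  have hαA : ∀ i ≤ n, αs i ∈ A := fun i hi => (hmem i hi).2
  have hα0 : ∀ i ≤ n, 0 ≤ αs i := fun i hi => h0 ▸ partition_le hlt (Nat.zero_le i) hi
  have hαr : ∀ i ≤ n, αs i ≤ r := fun i hi => hn ▸ partition_le hlt hi le_rfl
  have hfix : ∀ z ∈ H, ∀ i ≤ n, z (αs i) = αs i := by
    intro z hz i hi
    obtain ⟨hzm, hxz, hyz⟩ := (hH z).1 hz
    rcases (hmem i hi).1 with h | h | h | h
    · rw [h]; exact apply_zero_of_mem hzm
    · rw [h]; exact apply_r_of_mem hzm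
    · exact h.apply_eq hx hzm hxz
    · exact h.apply_eq hy hzm hyz
  let Hs : ℕ → Subgroup (Equiv.Perm ℝ) := fun i =>
    H ⊓ fixingSubgroup (Equiv.Perm ℝ) (Ioo (αs i) (αs (i + 1)))ᶜ
  have hHs : ∀ i z, z ∈ Hs i ↔ (z ∈ PLGroup r L A hL ∧ ∀ t ∉ Ioo (αs i) (αs (i + 1)), z t = t) ∧
      Commute x z ∧ Commute y z := by
    intro i z
    simp only [Hs, Subgroup.mem_inf, hH, mem_fixingSubgroup_iff, Equiv.Perm.smul_def,
      mem_compl_iff]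
    tauto
  have halt : ∀ i < n, (∀ t ∈ Ioo (αs i) (αs (i + 1)), x t = t ∧ y t = t) ∨
      (∀ z ∈ Hs i, z = 1) ∨ ∃ w ∈ Hs i, (∀ v ∈ PLGroup r L A hL,
        (∀ t ∉ Ioo (αs i) (αs (i + 1)), v t = t) → Commute w v → v ∈ Hs i) ∧
        ∀ z ∈ Hs i, ∃ n : ℤ, w ^ n = z := by
    intro i hi
    by_cases h : ∀ t ∈ Ioo (αs i) (αs (i + 1)), x t = t ∧ y t = t
    · exact Or.inl h
    refine Or.inr (centralizer_irredOn hx hy (hlt i hi) (irredOn_of_ne hx hy ?_ ?_) (hHs i))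
    · refine fun p hp hpA => ⟨fun hb => ?_, fun hb => ?_⟩
      · exact hgap i hi p hp ⟨Or.inr (Or.inr (Or.inl hb)), hpA⟩
      · exact hgap i hi p hp ⟨Or.inr (Or.inr (Or.inr hb)), hpA⟩
    · push Not at h
      obtain ⟨t, ht, h⟩ := h
      exact ⟨t, ht, by tauto⟩
  have hfull : ∀ i < n, (Hs i : Set (Equiv.Perm ℝ)) =
      {y : Equiv.Perm ℝ | memFS r L A (Ioo (αs i) (αs (i + 1))) y} →
      ∀ t ∈ Ioo (αs i) (αs (i + 1)), x t = t ∧ y t = t := by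
    intro i hi hf
    refine (halt i hi).resolve_right fun h => ?_
    refine ne_memFS_of_commute hr hL hLne hA (hαA i hi.le) (hαA (i + 1) hi) (hα0 i hi.le)
      (hlt i hi) (hαr (i + 1) hi) (fun f hf g hg => ?_) hf
    rcases h with h | ⟨w, -, -, h⟩
    · rw [h f hf, h g hg]
    · obtain ⟨k, rfl⟩ := h f hf
      obtain ⟨l, rfl⟩ := h g hg
      exact Commute.zpow_zpow_self w k l
  refine ⟨n, αs, Hs, h0, hn, hlt, hαA, ?_, fun i hi => ?_, fun i hi hf₁ hf₂ => ?_⟩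
  · have hsupp : ∀ i < n, ∀ z ∈ Hs i, ∀ t ∉ Ioo (αs i) (αs (i + 1)), z t = t :=
      fun i _ z hz => ((hHs i z).1 hz).1.2
    refine (isInternalDirectProduct_iff hlt hsupp).2 fun z => ⟨fun hz => ⟨fun t ht => ?_,
      fun i hi => ?_⟩, fun ⟨h1, h2⟩ => ?_⟩
    · by_cases htI : t ∈ Ioo 0 r
      · rcases partition_cover (αs := αs) (n := n) (h0 ▸ htI.1.le) (hn ▸ htI.2.le) with
          ⟨i, hi, h⟩ | ⟨i, hi, rfl⟩
        · exact absurd h (ht i hi)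
        · exact hfix z hz i hi
      · exact apply_eq_of_notMem_Ioo ((hH z).1 hz).1 htI
    · obtain ⟨hzm, hxz, hyz⟩ := (hH z).1 hz
      have hza := hfix z hz i hi.le
      have hzb := hfix z hz (i + 1) hi
      obtain ⟨w, hw, hw1, hw2⟩ := exists_restrict hzm (hαA i hi.le) (hαA (i + 1) hi) (hlt i hi)
        hza hzb
      exact ⟨w, (hHs i w).2 ⟨⟨hw, hw2⟩, commute_restrict hx hzm hxz hza hzb hw1 hw2,
        commute_restrict hy hzm hyz hza hzb hw1 hw2⟩, fun t ht => (hw1 t ht).symm⟩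
    · choose! w hw hzw using h2
      rw [eq_prod_of_disjoint (partition_disjoint hlt) (f := fun i : Fin n => w i)
        (fun i => hsupp i i.2 _ (hw i i.2)) (fun i => hzw i i.2)
        fun t ht => h1 t fun i hi => ht ⟨i, hi⟩]
      refine list_prod_mem fun v hv => ?_
      obtain ⟨i, rfl⟩ := List.mem_ofFn.1 hv
      exact (hw i i.2).1
  · rcases halt i hi with h | h | ⟨w, hw, h1, h2⟩
    · refine Or.inr (Or.inl (Set.ext fun z => ?_))
      rw [SetLike.mem_coe, hHs, Set.mem_ofPred_eq, memFS_iff hA (hL := hL), and_iff_left_iff_imp]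
      rintro ⟨-, hz⟩
      refine ⟨Equiv.Perm.Disjoint.commute fun t => ?_, Equiv.Perm.Disjoint.commute fun t => ?_⟩
      · exact (em (t ∈ Ioo (αs i) (αs (i + 1)))).imp (fun ht => (h t ht).1) (hz t)
      · exact (em (t ∈ Ioo (αs i) (αs (i + 1)))).imp (fun ht => (h t ht).2) (hz t)
    · exact Or.inl (Set.eq_singleton_iff_unique_mem.2 ⟨one_mem (Hs i), h⟩)
    · refine Or.inr (Or.inr ⟨w, (memFS_iff hA).2 ((hHs i w).1 hw).1, ?_, ?_⟩)
      · ext z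
        rw [SetLike.mem_coe, Set.mem_ofPred_eq, memFS_iff hA (hL := hL)]
        refine ⟨fun hz => ⟨((hHs i z).1 hz).1, ?_⟩, fun hz => h1 z hz.1.1 hz.1.2 hz.2⟩
        obtain ⟨m, rfl⟩ := h2 z hz
        exact (Commute.refl w).zpow_right m
      · ext z
        refine ⟨h2 z, ?_⟩
        rintro ⟨m, rfl⟩
        exact zpow_mem hw m
  · have g1 := hfull i (by lia) hf₁
    have g2 := hfull (i + 1) hi hf₂
    have hl1 := hlt i (by lia)
    have hl2 := hlt (i + 1) hi
    have hid : ∀ w ∈ PLGroup r L A hL, (∀ t ∈ Ioo (αs i) (αs (i + 1)), w t = t) →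
        (∀ t ∈ Ioo (αs (i + 1)) (αs (i + 1 + 1)), w t = t) → LocId w (αs (i + 1)) := by
      intro w hw hw1 hw2
      have hcl : IsClosed {s | w s = s} := isClosed_eq (continuous_of_mem hw) continuous_id
      have hp : w (αs (i + 1)) = αs (i + 1) := by
        refine closure_minimal hw1 hcl ?_
        rw [closure_Ioo hl1.ne]
        exact ⟨hl1.le, le_rfl⟩
      filter_upwards [Ioo_mem_nhds hl1 hl2] with t ht
      rcases lt_trichotomy t (αs (i + 1)) with h | h | h
      · exact hw1 t ⟨ht.1, h⟩
      · rw [h, hp]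
      · exact hw2 t ⟨h, ht.2⟩
    rcases (hmem (i + 1) hi.le).1 with h | h | h | h
    · linarith [hα0 i (by lia)]
    · linarith [hαr (i + 1 + 1) hi]
    · exact h.2 (hid x hx (fun t ht => (g1 t ht).1) fun t ht => (g2 t ht).1)
    · exact h.2 (hid y hy (fun t ht => (g1 t ht).2) fun t ht => (g2 t ht).2)

theorem exists_pair_trivial (hr : 0 < r) (hL : IsSlopeSubgroup L) (hLne : L ≠ {1})
    (hA : IsSlopeModule r L A) {a b : ℝ} (ha : a ∈ A) (hb : b ∈ A) (ha0 : 0 ≤ a) (hab : a < b)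
    (hbr : b ≤ r) :
    ∃ x y, memFS r L A (Ioo a b) x ∧ memFS r L A (Ioo a b) y ∧
      (∀ z, memFS r L A (Ioo a b) z → Commute x z → Commute y z → z = 1) ∧
      (¬ ∀ᶠ t in 𝓝[>] a, x t = t) ∧ ¬ ∀ᶠ t in 𝓝[<] b, x t = t := by
  obtain ⟨h, hhA, hh0, hh⟩ := exists_small_mem hr hL hLne hA (sub_pos.2 hab)
  have hcb : a + h < b := by linarith
  obtain ⟨x, hx, hx1, hx2⟩ := exists_bump (hL := hL) hr hLne hA ha hb ha0 hab hbr
  obtain ⟨y, hy, hy1, hy2⟩ := exists_bump (hL := hL) hr hLne hA ha (hA.2.2.1 _ ha _ hhA) ha0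
    (by linarith) (hcb.le.trans hbr)
  refine ⟨x, y, (memFS_iff hA).2 ⟨hx, hx2⟩, (memFS_iff hA).2 ⟨hy, fun t ht => hy2 t fun h' => ht
    ⟨h'.1, h'.2.trans hcb⟩⟩, fun z hz hxz hyz => ?_, fun h' => ?_, fun h' => ?_⟩
  · obtain ⟨hzm, hz⟩ := (memFS_iff hA (hL := hL)).1 hz
    have hzc : z (a + h) = a + h := by
      refine FixBdry.apply_eq hy hzm hyz ⟨hy2 _ fun h' => h'.2.false, fun h' => ?_⟩
      obtain ⟨q, hq, hq'⟩ := exists_locId_left (show a < a + h by linarith)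
        (h'.filter_mono nhdsWithin_le_nhds)
      exact (hy1 q hq).ne' hq'.eq
    ext t
    by_cases ht : t ∈ Ioo a b
    · exact eq_of_fixed hx hzm hxz (hx2 a fun h' => h'.1.false) (hx2 b fun h' => h'.2.false)
        (fun s hs => (hx1 s hs).ne') ⟨by linarith, hcb⟩ hzc t ht
    · exact hz t ht
  · obtain ⟨q, hq, hq'⟩ := exists_locId_right hab h'
    exact (hx1 q hq).ne' hq'.eq
  · obtain ⟨q, hq, hq'⟩ := exists_locId_left hab h'
    exact (hx1 q hq).ne' hq'.eq

theorem not_eventually_eq_of_commute (hr : 0 < r) (hL : IsSlopeSubgroup L) (hLne : L ≠ {1})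
    (hA : IsSlopeModule r L A) {a b : ℝ} (ha : a ∈ A) (hb : b ∈ A) (ha0 : 0 ≤ a) (hab : a < b)
    (hbr : b ≤ r) (hcomm : ∀ f, memFS r L A (Ioo a b) f → Commute x f →
      ∀ g, memFS r L A (Ioo a b) g → Commute x g → Commute f g) :
    (¬ ∀ᶠ t in 𝓝[>] a, x t = t) ∧ ¬ ∀ᶠ t in 𝓝[<] b, x t = t := by
  have key : ∀ c ∈ A, ∀ d ∈ A, a ≤ c → c < d → d ≤ b → ¬ ∀ t ∈ Ioo c d, x t = t := by
    intro c hc d hd hac hcd hdb hid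
    obtain ⟨f, hf, g, hg, hf', hg', hfg⟩ :=
      exists_not_commute (hL := hL) hr hLne hA hc hd (ha0.trans hac) hcd (hdb.trans hbr)
    have h1 : ∀ f ∈ PLGroup r L A hL, (∀ t ∉ Ioo c d, f t = t) →
        memFS r L A (Ioo a b) f ∧ Commute x f := fun f hf hf' =>
      ⟨(memFS_iff hA).2 ⟨hf, fun t ht => hf' t fun h => ht (Ioo_subset_Ioo hac hdb h)⟩,
        Equiv.Perm.Disjoint.commute fun t => (em (t ∈ Ioo c d)).imp (hid t) (hf' t)⟩
    exact hfg (hcomm f (h1 f hf hf').1 (h1 f hf hf').2 g (h1 g hg hg').1 (h1 g hg hg').2)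
  constructor
  · intro h
    obtain ⟨u, hu, hid⟩ := mem_nhdsGT_iff_exists_Ioo_subset.1 h
    obtain ⟨h, hhA, hh0, hh⟩ := exists_small_mem hr hL hLne hA
      (lt_min (sub_pos.2 hab) (sub_pos.2 hu))
    have h1 := hh.trans_le (min_le_left _ _)
    have h2 := hh.trans_le (min_le_right _ _)
    exact key a ha _ (hA.2.2.1 _ ha _ hhA) le_rfl (by linarith) (by linarith)
      fun t ht => hid ⟨ht.1, by linarith [ht.2]⟩
  · intro h
    obtain ⟨u, hu, hid⟩ := mem_nhdsLT_iff_exists_Ioo_subset.1 h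
    obtain ⟨h, hhA, hh0, hh⟩ := exists_small_mem hr hL hLne hA
      (lt_min (sub_pos.2 hab) (sub_pos.2 hu))
    have h1 := hh.trans_le (min_le_left _ _)
    have h2 := hh.trans_le (min_le_right _ _)
    exact key (b + -h) (hA.2.2.1 _ hb _ (hA.2.2.2.1 _ hhA)) b hb (by linarith) (by linarith) le_rfl
      fun t ht => hid ⟨by linarith [ht.1], ht.2⟩

/-- Each of the factors is the centralizer of a pair of elements, the first of which is nontrivial
near both end points unless the factor is full. -/
theorem exists_pair_factor (hr : 0 < r) (hL : IsSlopeSubgroup L) (hLne : L ≠ {1})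
    (hA : IsSlopeModule r L A) {a b : ℝ} (ha : a ∈ A) (hb : b ∈ A) (ha0 : 0 ≤ a) (hab : a < b)
    (hbr : b ≤ r) {K : Set (Equiv.Perm ℝ)}
    (hK : K = {1} ∨ K = {y | memFS r L A (Ioo a b) y} ∨
      ∃ x, memFS r L A (Ioo a b) x ∧ K = {y | memFS r L A (Ioo a b) y ∧ Commute x y} ∧
        K = Set.range fun m : ℤ => x ^ m) :
    ∃ x y, memFS r L A (Ioo a b) x ∧ memFS r L A (Ioo a b) y ∧
      (∀ z, z ∈ K ↔ memFS r L A (Ioo a b) z ∧ Commute x z ∧ Commute y z) ∧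
      (K ≠ {y | memFS r L A (Ioo a b) y} →
        (¬ ∀ᶠ t in 𝓝[>] a, x t = t) ∧ ¬ ∀ᶠ t in 𝓝[<] b, x t = t) := by
  have hone : memFS r L A (Ioo a b) 1 :=
    (memFS_iff hA (hL := hL)).2 ⟨one_mem _, fun t _ => rfl⟩
  rcases hK with rfl | rfl | ⟨x, hx, hK, hK'⟩
  · obtain ⟨x, y, hx, hy, h1, h2⟩ := exists_pair_trivial hr hL hLne hA ha hb ha0 hab hbr
    refine ⟨x, y, hx, hy, fun z => ⟨?_, fun h => h1 z h.1 h.2.1 h.2.2⟩, fun _ => h2⟩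
    rintro rfl
    exact ⟨hone, Commute.one_right x, Commute.one_right y⟩
  · exact ⟨1, 1, hone, hone, fun z => ⟨fun h => ⟨h, Commute.one_left z, Commute.one_left z⟩,
      fun h => h.1⟩, fun h => absurd rfl h⟩
  · refine ⟨x, x, hx, hx, fun z => by rw [hK]; simp, fun _ =>
      not_eventually_eq_of_commute hr hL hLne hA ha hb ha0 hab hbr fun f hf hxf g hg hxg => ?_⟩
    have hf' : f ∈ K := hK ▸ ⟨hf, hxf⟩
    have hg' : g ∈ K := hK ▸ ⟨hg, hxg⟩
    rw [hK'] at hf' hg'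
    obtain ⟨k, rfl⟩ := hf'
    obtain ⟨l, rfl⟩ := hg'
    exact Commute.zpow_zpow_self x k l

theorem commute_of_factors {n : ℕ} {αs : ℕ → ℝ} {u v : ℕ → Equiv.Perm ℝ}
    (hu : ∀ i < n, ∀ t ∉ Ioo (αs i) (αs (i + 1)), u i t = t)
    (hv : ∀ i < n, ∀ t ∉ Ioo (αs i) (αs (i + 1)), v i t = t)
    (huv : ∀ i < n, Commute (u i) (v i))
    (hx : ∀ i < n, ∀ t ∈ Ioo (αs i) (αs (i + 1)), x t = u i t)
    (hx' : ∀ t, (∀ i < n, t ∉ Ioo (αs i) (αs (i + 1))) → x t = t)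
    (hz : ∀ i < n, ∀ t ∈ Ioo (αs i) (αs (i + 1)), z t = v i t)
    (hz' : ∀ t, (∀ i < n, t ∉ Ioo (αs i) (αs (i + 1))) → z t = t) : Commute x z := by
  ext t
  simp only [Equiv.Perm.mul_apply]
  by_cases ht : ∃ i < n, t ∈ Ioo (αs i) (αs (i + 1))
  · obtain ⟨i, hi, ht⟩ := ht
    rw [hz i hi t ht, hx i hi t ht, hx i hi _ (apply_mem_of_fix_compl (hv i hi) ht),
      hz i hi _ (apply_mem_of_fix_compl (hu i hi) ht), (huv i hi).perm_apply]
  · push Not at ht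
    rw [hz' t ht, hx' t ht, hz' t ht]

theorem exists_pair_of_decomposition (hr : 0 < r) (hL : IsSlopeSubgroup L) (hLne : L ≠ {1})
    (hA : IsSlopeModule r L A) {H : Subgroup (Equiv.Perm ℝ)} (hH : ∀ h ∈ H, memF r L A h)
    {n : ℕ} {αs : ℕ → ℝ} {Hs : ℕ → Subgroup (Equiv.Perm ℝ)} (h0 : αs 0 = 0) (hn : αs n = r)
    (hlt : ∀ i < n, αs i < αs (i + 1)) (hαA : ∀ i ≤ n, αs i ∈ A)
    (hprod : IsInternalDirectProduct H n Hs)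
    (hHs : ∀ i < n,
      ((Hs i : Set (Equiv.Perm ℝ)) = {(1 : Equiv.Perm ℝ)}) ∨
      ((Hs i : Set (Equiv.Perm ℝ)) =
          {y : Equiv.Perm ℝ | memFS r L A (Ioo (αs i) (αs (i + 1))) y}) ∨
      (∃ x : Equiv.Perm ℝ, memFS r L A (Ioo (αs i) (αs (i + 1))) x ∧
        (Hs i : Set (Equiv.Perm ℝ)) =
          {y : Equiv.Perm ℝ |
            memFS r L A (Ioo (αs i) (αs (i + 1))) y ∧ Commute x y} ∧
        (Hs i : Set (Equiv.Perm ℝ)) = Set.range fun m : ℤ => x ^ m))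
    (hfull : ∀ i, i + 1 < n →
      (Hs i : Set (Equiv.Perm ℝ)) =
        {y : Equiv.Perm ℝ | memFS r L A (Ioo (αs i) (αs (i + 1))) y} →
      (Hs (i + 1) : Set (Equiv.Perm ℝ)) ≠
        {y : Equiv.Perm ℝ | memFS r L A (Ioo (αs (i + 1)) (αs (i + 2))) y}) :
    ∃ x ∈ PLGroup r L A hL, ∃ y ∈ PLGroup r L A hL,
      ∀ z, z ∈ H ↔ z ∈ PLGroup r L A hL ∧ Commute x z ∧ Commute y z := by
  have hα0 : ∀ i ≤ n, 0 ≤ αs i := fun i hi => h0 ▸ partition_le hlt (Nat.zero_le i) hi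
  have hαr : ∀ i ≤ n, αs i ≤ r := fun i hi => hn ▸ partition_le hlt hi le_rfl
  have hpair := fun i (hi : i < n) => exists_pair_factor hr hL hLne hA (hαA i hi.le)
    (hαA (i + 1) hi) (hα0 i hi.le) (hlt i hi) (hαr (i + 1) hi) (hHs i hi)
  choose! X Y hX hY hmem hgerm using hpair
  have hXm : ∀ i < n, X i ∈ PLGroup r L A hL ∧ ∀ t ∉ Ioo (αs i) (αs (i + 1)), X i t = t :=
    fun i hi => (memFS_iff hA).1 (hX i hi)
  have hYm : ∀ i < n, Y i ∈ PLGroup r L A hL ∧ ∀ t ∉ Ioo (αs i) (αs (i + 1)), Y i t = t :=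
    fun i hi => (memFS_iff hA).1 (hY i hi)
  have hHsm : ∀ i < n, ∀ z ∈ Hs i, ∀ t ∉ Ioo (αs i) (αs (i + 1)), z t = t := fun i hi z hz =>
    ((memFS_iff hA (hL := hL)).1 ((hmem i hi z).1 hz).1).2
  have hdisj := partition_disjoint hlt
  obtain ⟨hx1, hx2⟩ := prod_apply_of_disjoint hdisj (f := fun i => X i) fun i => (hXm i i.2).2
  obtain ⟨hy1, hy2⟩ := prod_apply_of_disjoint hdisj (f := fun i => Y i) fun i => (hYm i i.2).2
  have hx : (List.ofFn fun i : Fin n => X i).prod ∈ PLGroup r L A hL := by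
    refine list_prod_mem fun v hv => ?_
    obtain ⟨i, rfl⟩ := List.mem_ofFn.1 hv
    exact (hXm i i.2).1
  have hy : (List.ofFn fun i : Fin n => Y i).prod ∈ PLGroup r L A hL := by
    refine list_prod_mem fun v hv => ?_
    obtain ⟨i, rfl⟩ := List.mem_ofFn.1 hv
    exact (hYm i i.2).1
  set x := (List.ofFn fun i : Fin n => X i).prod
  set y := (List.ofFn fun i : Fin n => Y i).prod
  replace hx1 : ∀ i < n, ∀ t ∈ Ioo (αs i) (αs (i + 1)), x t = X i t := fun i hi => hx1 ⟨i, hi⟩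
  replace hx2 : ∀ t, (∀ i < n, t ∉ Ioo (αs i) (αs (i + 1))) → x t = t :=
    fun t ht => hx2 t fun i => ht i i.2
  replace hy1 : ∀ i < n, ∀ t ∈ Ioo (αs i) (αs (i + 1)), y t = Y i t := fun i hi => hy1 ⟨i, hi⟩
  replace hy2 : ∀ t, (∀ i < n, t ∉ Ioo (αs i) (αs (i + 1))) → y t = t :=
    fun t ht => hy2 t fun i => ht i i.2
  have hiff := (isInternalDirectProduct_iff hlt hHsm).1 hprod
  refine ⟨x, hx, y, hy, fun z => ⟨fun hz => ⟨mem_of_memF hA (hH z hz), ?_⟩, ?_⟩⟩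
  · obtain ⟨hz2, hz1⟩ := (hiff z).1 hz
    choose! w hw hz1 using hz1
    exact ⟨commute_of_factors (fun i hi => (hXm i hi).2) (fun i hi => hHsm i hi _ (hw i hi))
      (fun i hi => ((hmem i hi _).1 (hw i hi)).2.1) hx1 hx2 hz1 hz2,
      commute_of_factors (fun i hi => (hYm i hi).2) (fun i hi => hHsm i hi _ (hw i hi))
      (fun i hi => ((hmem i hi _).1 (hw i hi)).2.2) hy1 hy2 hz1 hz2⟩
  · rintro ⟨hz, hxz, hyz⟩
    have hxα : ∀ j ≤ n, x (αs j) = αs j := fun j hj => hx2 _ fun i hi h => by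
      rcases lt_or_ge i j with h' | h'
      · exact h.2.not_ge (partition_le hlt h' hj)
      · exact h.1.not_ge (partition_le hlt h' hi.le)
    have hzα : ∀ j ≤ n, z (αs j) = αs j := by
      rintro (_ | i) hj
      · rw [h0]; exact apply_zero_of_mem hz
      rcases hj.eq_or_lt with rfl | hj'
      · rw [hn]; exact apply_r_of_mem hz
      refine FixBdry.apply_eq hx hz hxz ⟨hxα _ hj, fun hloc => ?_⟩
      by_cases hfi : (Hs i : Set (Equiv.Perm ℝ)) =
          {y : Equiv.Perm ℝ | memFS r L A (Ioo (αs i) (αs (i + 1))) y}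
      · refine (hgerm (i + 1) hj' (hfull i hj' hfi)).1 ?_
        filter_upwards [hloc.filter_mono nhdsWithin_le_nhds, Ioo_mem_nhdsGT (hlt _ hj')] with t h ht
        rw [← hx1 _ hj' t ht, h]
      · refine (hgerm i hj hfi).2 ?_
        filter_upwards [hloc.filter_mono nhdsWithin_le_nhds, Ioo_mem_nhdsLT (hlt i hj)] with t h ht
        rw [← hx1 i hj t ht, h]
    refine (hiff z).2 ⟨fun t ht => ?_, fun i hi => ?_⟩
    · by_cases htI : t ∈ Ioo 0 r
      · rcases partition_cover (αs := αs) (n := n) (h0 ▸ htI.1.le) (hn ▸ htI.2.le) with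
          ⟨i, hi, h⟩ | ⟨i, hi, rfl⟩
        · exact absurd h (ht i hi)
        · exact hzα i hi
      · exact apply_eq_of_notMem_Ioo hz htI
    · obtain ⟨w, hw, hw1, hw2⟩ := exists_restrict hz (hαA i hi.le) (hαA (i + 1) hi) (hlt i hi)
        (hzα i hi.le) (hzα (i + 1) hi)
      have hcomm : ∀ {u u' : Equiv.Perm ℝ}, Commute u z →
          (∀ t ∈ Ioo (αs i) (αs (i + 1)), u t = u' t) →
          (∀ t ∉ Ioo (αs i) (αs (i + 1)), u' t = t) → Commute u' w := by
        intro u u' huz hu1 hu2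
        ext t
        simp only [Equiv.Perm.mul_apply]
        by_cases ht : t ∈ Ioo (αs i) (αs (i + 1))
        · rw [hw1 _ (apply_mem_of_fix_compl hu2 ht), ← hu1 _ (apply_mem_of_fix_compl hw2 ht),
            hw1 t ht, ← hu1 t ht, huz.perm_apply]
        · rw [hw2 t ht, hu2 t ht, hw2 t ht]
      exact ⟨w, (hmem i hi w).2 ⟨(memFS_iff hA).2 ⟨hw, hw2⟩,
        hcomm hxz (hx1 i hi) (hXm i hi).2, hcomm hyz (hy1 i hi) (hYm i hi).2⟩,
        fun t ht => (hw1 t ht).symm⟩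

end PiecewiseLinearGerms

/-- A subgroup `H` of `F` is the centralizer in `F` of a pair of
(possibly equal) elements if and only if `H` decomposes as an internal direct
product of subgroups `H₁, …, Hₙ` along a partition `0 = α₀ < α₁ < ⋯ < αₙ = r` with
all `αᵢ ∈ A`, where each `Hᵢ` is either trivial, or the whole of `F_{(αᵢ₋₁,αᵢ)}`,
or is the centralizer of some element `x` of `F_{(αᵢ₋₁,αᵢ)}` in `F_{(αᵢ₋₁,αᵢ)}` and
is the cyclic group `⟨x⟩`; and no two consecutive factors are both full groups. -/
theorem centralizer_pair_characterization (r : ℝ) (L A : Set ℝ) (hr : 0 < r)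
    (hL : IsSlopeSubgroup L) (hLne : L ≠ {1}) (hA : IsSlopeModule r L A)
    (H : Subgroup (Equiv.Perm ℝ)) (hH : ∀ h ∈ H, memF r L A h) :
    (∃ x y : Equiv.Perm ℝ, memF r L A x ∧ memF r L A y ∧
        (H : Set (Equiv.Perm ℝ)) =
          {z : Equiv.Perm ℝ | memF r L A z ∧ Commute x z ∧ Commute y z}) ↔
      ∃ (n : ℕ) (αs : ℕ → ℝ) (Hs : ℕ → Subgroup (Equiv.Perm ℝ)),
        αs 0 = 0 ∧ αs n = r ∧ (∀ i < n, αs i < αs (i + 1)) ∧ (∀ i ≤ n, αs i ∈ A) ∧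
        IsInternalDirectProduct H n Hs ∧
        (∀ i < n,
          ((Hs i : Set (Equiv.Perm ℝ)) = {(1 : Equiv.Perm ℝ)}) ∨
          ((Hs i : Set (Equiv.Perm ℝ)) =
              {y : Equiv.Perm ℝ | memFS r L A (Ioo (αs i) (αs (i + 1))) y}) ∨
          (∃ x : Equiv.Perm ℝ, memFS r L A (Ioo (αs i) (αs (i + 1))) x ∧
            (Hs i : Set (Equiv.Perm ℝ)) =
              {y : Equiv.Perm ℝ |
                memFS r L A (Ioo (αs i) (αs (i + 1))) y ∧ Commute x y} ∧
            (Hs i : Set (Equiv.Perm ℝ)) = Set.range fun m : ℤ => x ^ m)) ∧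
        (∀ i, i + 1 < n →
          (Hs i : Set (Equiv.Perm ℝ)) =
            {y : Equiv.Perm ℝ | memFS r L A (Ioo (αs i) (αs (i + 1))) y} →
          (Hs (i + 1) : Set (Equiv.Perm ℝ)) ≠
            {y : Equiv.Perm ℝ | memFS r L A (Ioo (αs (i + 1)) (αs (i + 2))) y}) := by
  constructor
  · rintro ⟨x, y, hx, hy, hxy⟩
    have hmem : ∀ z, z ∈ H ↔ z ∈ PLGroup r L A hL ∧ Commute x z ∧ Commute y z := fun z => by
      rw [← memF_iff hA, ← SetLike.mem_coe, hxy, Set.mem_ofPred_eq]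
    exact exists_decomposition hr hL hLne hA (mem_of_memF hA hx) (mem_of_memF hA hy) hmem
  · rintro ⟨n, αs, Hs, h0, hn, hlt, hαA, hprod, hHs, hfull⟩
    obtain ⟨x, hx, y, hy, hxy⟩ :=
      exists_pair_of_decomposition hr hL hLne hA hH h0 hn hlt hαA hprod hHs hfull
    refine ⟨x, y, memF_of_mem hx, memF_of_mem hy, Set.ext fun z => ?_⟩
    rw [SetLike.mem_coe, hxy, Set.mem_ofPred_eq, memF_iff hA]
end

section
/- For all α, β ∈ A with 0 < α < β < r, there exist x, y ∈ F such that supp(x) = supp(y) = (α,β), x and y do not commute (x∘y ≠ y∘x), and the centralizer of the pair {x, y} in F_{(α,β)} is the trivial subgroup {id}. -/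
open Set

/-- The function which fixes every point outside `(α,β)` and, on `[α,β]`, has successive slopes
`p⁻¹`, `1`, `p`, the first and last pieces having lengths `s` and `p⁻¹ * s`. -/
noncomputable def bump (α β p s t : ℝ) : ℝ :=
  max t (min (α + p⁻¹ * (t - α)) (min (t + (p⁻¹ - 1) * s) (β + p * (t - β))))

section Bump

variable {α β p s t : ℝ}

lemma bump_of_le_left (hp : 0 < p) (hp1 : p < 1) (ht : t ≤ α) : bump α β p s t = t := by
  have hq : 1 < p⁻¹ := (one_lt_inv₀ hp).2 hp1
  refine max_eq_left ((min_le_left _ _).trans ?_)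
  nlinarith

lemma bump_of_ge_right (hp1 : p < 1) (ht : β ≤ t) : bump α β p s t = t := by
  refine max_eq_left (((min_le_right _ _).trans (min_le_right _ _)).trans ?_)
  nlinarith

lemma bump_of_mem_Icc (hp : 0 < p) (hp1 : p < 1) (hs : 0 < s) (ht : t ∈ Icc α β) :
    bump α β p s t =
      min (α + p⁻¹ * (t - α)) (min (t + (p⁻¹ - 1) * s) (β + p * (t - β))) := by
  have hq : 1 < p⁻¹ := (one_lt_inv₀ hp).2 hp1
  obtain ⟨h1, h2⟩ := ht
  refine max_eq_right (le_min ?_ (le_min ?_ ?_)) <;> nlinarith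

lemma lt_bump (hp : 0 < p) (hp1 : p < 1) (hs : 0 < s) (ht : t ∈ Ioo α β) :
    t < bump α β p s t := by
  have hq : 1 < p⁻¹ := (one_lt_inv₀ hp).2 hp1
  obtain ⟨h1, h2⟩ := ht
  refine lt_max_of_lt_right (lt_min ?_ (lt_min ?_ ?_)) <;> nlinarith

lemma bump_of_mem_first (hp : 0 < p) (hp1 : p < 1) (hs : 0 < s) (hsβ : s + p⁻¹ * s < β - α)
    (ht : t ∈ Icc α (α + s)) : bump α β p s t = α + p⁻¹ * (t - α) := by
  have hq : 1 < p⁻¹ := (one_lt_inv₀ hp).2 hp1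
  have hpq : p * p⁻¹ = 1 := mul_inv_cancel₀ hp.ne'
  obtain ⟨h1, h2⟩ := ht
  have h3 : α + p⁻¹ * (t - α) ≤ t + (p⁻¹ - 1) * s := by nlinarith
  have h4 : t + (p⁻¹ - 1) * s ≤ β + p * (t - β) := by
    have : 0 ≤ (1 - p) * (β - t - p⁻¹ * s) := mul_nonneg (by linarith) (by linarith)
    linear_combination this + s * hpq
  rw [bump_of_mem_Icc hp hp1 hs ⟨h1, by nlinarith⟩, min_eq_left (le_min h3 (h3.trans h4))]

lemma bump_of_mem_middle (hp : 0 < p) (hp1 : p < 1) (hs : 0 < s)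
    (ht : t ∈ Icc (α + s) (β - p⁻¹ * s)) : bump α β p s t = t + (p⁻¹ - 1) * s := by
  have hq : 1 < p⁻¹ := (one_lt_inv₀ hp).2 hp1
  have hpq : p * p⁻¹ = 1 := mul_inv_cancel₀ hp.ne'
  obtain ⟨h1, h2⟩ := ht
  have h3 : t + (p⁻¹ - 1) * s ≤ α + p⁻¹ * (t - α) := by nlinarith
  have h4 : t + (p⁻¹ - 1) * s ≤ β + p * (t - β) := by
    have : 0 ≤ (1 - p) * (β - t - p⁻¹ * s) := mul_nonneg (by linarith) (by linarith)
    linear_combination this + s * hpq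
  rw [bump_of_mem_Icc hp hp1 hs ⟨by linarith, by nlinarith⟩, min_eq_left h4, min_eq_right h3]

lemma bump_of_mem_last (hp : 0 < p) (hp1 : p < 1) (hs : 0 < s) (hsβ : s + p⁻¹ * s < β - α)
    (ht : t ∈ Icc (β - p⁻¹ * s) β) : bump α β p s t = β + p * (t - β) := by
  have hq : 1 < p⁻¹ := (one_lt_inv₀ hp).2 hp1
  have hpq : p * p⁻¹ = 1 := mul_inv_cancel₀ hp.ne'
  obtain ⟨h1, h2⟩ := ht
  have h3 : t + (p⁻¹ - 1) * s ≤ α + p⁻¹ * (t - α) := by nlinarith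
  have h4 : β + p * (t - β) ≤ t + (p⁻¹ - 1) * s := by
    have : 0 ≤ (1 - p) * (p⁻¹ * s - (β - t)) := mul_nonneg (by linarith) (by linarith)
    linear_combination this - s * hpq
  rw [bump_of_mem_Icc hp hp1 hs ⟨by linarith, h2⟩, min_eq_right h4, min_eq_right (h4.trans h3)]

lemma bump_le (hp : 0 < p) (hp1 : p < 1) (hs : 0 < s) (ht : t ∈ Icc α β) :
    bump α β p s t ≤ t + (p⁻¹ - 1) * s := by
  rw [bump_of_mem_Icc hp hp1 hs ht]
  exact (min_le_right _ _).trans (min_le_left _ _)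

lemma continuous_bump : Continuous (bump α β p s) := by
  unfold bump
  fun_prop

lemma strictMono_bump (hp : 0 < p) : StrictMono (bump α β p s) := by
  have hq : 0 < p⁻¹ := inv_pos.2 hp
  intro a b hab
  refine max_lt_max hab (lt_min ?_ (lt_min ?_ ?_))
  · exact (min_le_left _ _).trans_lt (by nlinarith)
  · exact ((min_le_right _ _).trans (min_le_left _ _)).trans_lt (by linarith)
  · exact ((min_le_right _ _).trans (min_le_right _ _)).trans_lt (by nlinarith)

lemma surjective_bump (hp : 0 < p) (hp1 : p < 1) : Function.Surjective (bump α β p s) := by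
  refine continuous_bump.surjective ?_ ?_
  · exact Filter.tendsto_atTop_mono (fun t => le_max_left _ _) Filter.tendsto_id
  · refine Filter.Tendsto.congr' ?_ Filter.tendsto_id
    filter_upwards [Filter.eventually_le_atBot α] with t ht
    exact (bump_of_le_left hp hp1 ht).symm

/-- `bump` as a permutation of `ℝ`. -/
noncomputable def bumpPerm (α β s : ℝ) (hp : 0 < p) (hp1 : p < 1) : Equiv.Perm ℝ :=
  Equiv.ofBijective (bump α β p s) ⟨(strictMono_bump hp).injective, surjective_bump hp hp1⟩

lemma bumpPerm_apply (hp : 0 < p) (hp1 : p < 1) : bumpPerm α β s hp hp1 t = bump α β p s t :=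
  rfl

lemma psupp_bumpPerm (hp : 0 < p) (hp1 : p < 1) (hs : 0 < s) :
    psupp (bumpPerm α β s hp hp1) = Ioo α β := by
  ext t
  simp only [psupp, mem_ofPred_eq, bumpPerm_apply]
  refine ⟨fun h => ⟨?_, ?_⟩, fun h => (lt_bump hp hp1 hs h).ne'⟩
  · by_contra! h'
    exact h (bump_of_le_left hp hp1 h')
  · by_contra! h'
    exact h (bump_of_ge_right hp1 h')

end Bump

lemma AffOn.exists_Ioo_of_mem {f : ℝ → ℝ} {u : Set ℝ} {k x : ℝ} (hu : IsOpen u) (hx : x ∈ u)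
    (h : AffOn f u k) : ∃ ε > 0, AffOn f (Ioo (x - ε) (x + ε)) k := by
  obtain ⟨ε, hε, hsub⟩ := Metric.isOpen_iff.1 hu x hx
  obtain ⟨m, hm⟩ := h
  rw [Real.ball_eq_Ioo] at hsub
  exact ⟨ε, hε, m, fun y hy => hm y (hsub hy)⟩

lemma memF_bumpPerm {r α β p s : ℝ} {L A : Set ℝ} (hL : IsSlopeSubgroup L)
    (hA : IsSlopeModule r L A) (hαA : α ∈ A) (hβA : β ∈ A) (h0α : 0 < α) (hβr : β < r)
    (hp : 0 < p) (hp1 : p < 1) (hpL : p ∈ L) (hs : 0 < s) (hsA : s ∈ A)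
    (hsβ : s + p⁻¹ * s < β - α) : memF r L A (bumpPerm α β s hp hp1) := by
  obtain ⟨-, h1L, -, hinv⟩ := hL
  obtain ⟨-, -, hadd, hneg, hmul⟩ := hA
  have hqs : 0 < p⁻¹ * s := mul_pos (inv_pos.2 hp) hs
  have hqsA : p⁻¹ * s ∈ A := hmul _ (hinv p hpL) _ hsA
  refine ⟨fun t ht => ?_, continuous_bump, {α, α + s, β - p⁻¹ * s, β}, ?_, ?_, ?_⟩
  · rw [bumpPerm_apply]
    rcases le_or_gt t α with h | h
    · exact bump_of_le_left hp hp1 h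
    · refine bump_of_ge_right hp1 ?_
      by_contra! h'
      exact ht ⟨by linarith, by linarith⟩
  · intro t ht
    simp only [Finset.coe_insert, Finset.coe_singleton, mem_insert_iff, mem_singleton_iff] at ht
    rcases ht with rfl | rfl | rfl | rfl
    · exact ⟨hαA, by linarith, by linarith⟩
    · exact ⟨hadd _ hαA _ hsA, by linarith, by linarith⟩
    · exact ⟨sub_eq_add_neg β _ ▸ hadd _ hβA _ (hneg _ hqsA), by linarith, by linarith⟩
    · exact ⟨hβA, by linarith, by linarith⟩
  · intro t ht
    simp only [Finset.mem_insert, Finset.mem_singleton] at ht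
    rw [bumpPerm_apply]
    rcases ht with rfl | rfl | rfl | rfl
    · rwa [bump_of_le_left hp hp1 le_rfl]
    · rw [bump_of_mem_first hp hp1 hs hsβ ⟨by linarith, le_rfl⟩, add_sub_cancel_left]
      exact hadd _ hαA _ hqsA
    · have h : β - p⁻¹ * s + (p⁻¹ - 1) * s = β + -s := by ring
      rw [bump_of_mem_middle hp hp1 hs ⟨by linarith, le_rfl⟩, h]
      exact hadd _ hβA _ (hneg _ hsA)
    · rwa [bump_of_ge_right hp1 le_rfl]
  · intro t ht
    simp only [Finset.coe_insert, Finset.coe_singleton, mem_insert_iff, mem_singleton_iff,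
      not_or] at ht
    obtain ⟨h1, h2, h3, h4⟩ := ht
    suffices h : ∃ u : Set ℝ, IsOpen u ∧ t ∈ u ∧ ∃ k ∈ L, AffOn (bump α β p s) u k by
      obtain ⟨u, hu, htu, k, hk, haff⟩ := h
      obtain ⟨ε, hε, hε'⟩ := haff.exists_Ioo_of_mem hu htu
      exact ⟨ε, hε, k, hk, hε'⟩
    rcases lt_or_gt_of_ne h1 with h1 | h1
    · exact ⟨Iio α, isOpen_Iio, h1, 1, h1L, 0, fun u hu => by
        rw [bump_of_le_left hp hp1 (le_of_lt hu)]; ring⟩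
    rcases lt_or_gt_of_ne h2 with h2 | h2
    · exact ⟨Ioo α (α + s), isOpen_Ioo, ⟨h1, h2⟩, p⁻¹, hinv p hpL, α - p⁻¹ * α, fun u hu => by
        rw [bump_of_mem_first hp hp1 hs hsβ (Ioo_subset_Icc_self hu)]; ring⟩
    rcases lt_or_gt_of_ne h3 with h3 | h3
    · exact ⟨Ioo (α + s) (β - p⁻¹ * s), isOpen_Ioo, ⟨h2, h3⟩, 1, h1L, (p⁻¹ - 1) * s,
        fun u hu => by rw [bump_of_mem_middle hp hp1 hs (Ioo_subset_Icc_self hu)]; ring⟩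
    rcases lt_or_gt_of_ne h4 with h4 | h4
    · exact ⟨Ioo (β - p⁻¹ * s) β, isOpen_Ioo, ⟨h3, h4⟩, p, hpL, β - p * β, fun u hu => by
        rw [bump_of_mem_last hp hp1 hs hsβ (Ioo_subset_Icc_self hu)]; ring⟩
    · exact ⟨Ioi β, isOpen_Ioi, h4, 1, h1L, 0, fun u hu => by
        rw [bump_of_ge_right hp1 (le_of_lt hu)]; ring⟩

/-- A function that is locally affine on an open interval is affine on it. -/
lemma exists_affOn_Ioo_of_locally {f : ℝ → ℝ} {a b : ℝ}
    (h : ∀ x ∈ Ioo a b, ∃ ε > 0, ∃ k, AffOn f (Ioo (x - ε) (x + ε)) k) :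
    ∃ k, AffOn f (Ioo a b) k := by
  have hloc : ∀ x ∈ Ioo a b, ∃ k, ∀ᶠ y in nhds x, HasDerivAt f k y := by
    intro x hx
    obtain ⟨ε, hε, k, m, hm⟩ := h x hx
    refine ⟨k, ?_⟩
    filter_upwards [Ioo_mem_nhds (show x - ε < x by linarith) (show x < x + ε by linarith)]
      with y hy
    have hd : HasDerivAt (fun y => k * y + m) k y := by
      simpa using ((hasDerivAt_id y).const_mul k).add_const m
    refine hd.congr_of_eventuallyEq ?_
    filter_upwards [isOpen_Ioo.mem_nhds hy] with w hw using hm w hw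
  have hdd : ∀ x ∈ Ioo a b, HasDerivAt (deriv f) 0 x := by
    intro x hx
    obtain ⟨k, hk⟩ := hloc x hx
    exact (hasDerivAt_const x k).congr_of_eventuallyEq (hk.mono fun y hy => hy.deriv)
  rcases (Ioo a b).eq_empty_or_nonempty with he | ⟨c, hc⟩
  · exact ⟨0, 0, by simp [he]⟩
  have hconst : ∀ x ∈ Ioo a b, deriv f x = deriv f c := fun x hx =>
    isOpen_Ioo.is_const_of_deriv_eq_zero isPreconnected_Ioo
      (fun y hy => (hdd y hy).differentiableAt.differentiableWithinAt)
      (fun y hy => (hdd y hy).deriv) hx hc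
  have hg : ∀ x ∈ Ioo a b, HasDerivAt (fun y => f y - deriv f c * y) 0 x := by
    intro x hx
    obtain ⟨k, hk⟩ := hloc x hx
    have h1 := hk.self_of_nhds.differentiableAt.hasDerivAt
    rw [hconst x hx] at h1
    have h2 : HasDerivAt (fun y => deriv f c * y) (deriv f c) x := by
      simpa using (hasDerivAt_id x).const_mul (deriv f c)
    simpa using h1.fun_sub h2
  refine ⟨deriv f c, f c - deriv f c * c, fun x hx => ?_⟩
  have := isOpen_Ioo.is_const_of_deriv_eq_zero isPreconnected_Ioo
      (fun y hy => (hg y hy).differentiableAt.differentiableWithinAt)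
      (fun y hy => (hg y hy).deriv) hx hc
  linear_combination this

lemma PiecewiseAffine.exists_hasRightSlope {r : ℝ} {L A : Set ℝ} {f : Equiv.Perm ℝ}
    (hf : PiecewiseAffine r L A f) (a : ℝ) : ∃ k, HasRightSlope f a k := by
  obtain ⟨B, -, -, hB⟩ := hf
  have hmem : ((B.erase a : Finset ℝ) : Set ℝ)ᶜ ∈ nhds a :=
    (B.erase a).finite_toSet.isClosed.isOpen_compl.mem_nhds (by simp)
  obtain ⟨ε, hε, hsub⟩ := Metric.mem_nhds_iff.1 hmem
  rw [Real.ball_eq_Ioo] at hsub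
  obtain ⟨k, hk⟩ := exists_affOn_Ioo_of_locally (f := f) (a := a) (b := a + ε) fun x hx => by
    have hxB : x ∉ (B : Set ℝ) := fun hxB =>
      hsub ⟨by linarith [hx.1], hx.2⟩ (Finset.mem_coe.2 (Finset.mem_erase.2 ⟨hx.1.ne', hxB⟩))
    obtain ⟨δ, hδ, k, -, hk⟩ := hB x hxB
    exact ⟨δ, hδ, k, hk⟩
  exact ⟨k, a + ε, by linarith, hk⟩

lemma memF.strictMono {r : ℝ} {L A : Set ℝ} {f : Equiv.Perm ℝ} (hf : memF r L A f) :
    StrictMono f := by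
  rcases hf.2.1.strictMono_of_inj f.injective with h | h
  · exact h
  · have h1 := hf.1 (-1) (by simp)
    have h2 := hf.1 (-2) (by simp)
    have h3 := h (show (-2 : ℝ) < -1 by norm_num)
    linarith

lemma Equiv.Perm.apply_apply_of_commute {X : Type*} {f g : Equiv.Perm X} (h : Commute f g)
    (t : X) : f (g t) = g (f t) := by
  simpa using congrArg (fun e : Equiv.Perm X => e t) h.eq

/-- A strictly increasing permutation commuting with `x` and `y` does not increase the largest
point `γ` up to which `x` and `y` agree. -/
lemma apply_le_of_commute_of_agree {x y z : Equiv.Perm ℝ} {γ : ℝ} (hz : StrictMono z)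
    (hxz : Commute x z) (hyz : Commute y z) (heq : ∀ u ≤ γ, x u = y u)
    (hne : ∀ t > γ, ∃ u ≤ t, x u ≠ y u) : z γ ≤ γ := by
  by_contra! h
  obtain ⟨u, hu, hxy⟩ := hne _ h
  obtain ⟨v, rfl⟩ := z.surjective u
  refine hxy ?_
  rw [Equiv.Perm.apply_apply_of_commute hxz, Equiv.Perm.apply_apply_of_commute hyz,
    heq v (hz.le_iff_le.1 hu)]

lemma apply_eq_of_commute_of_agree {x y z : Equiv.Perm ℝ} {γ : ℝ} (hz : StrictMono z)
    (hxz : Commute x z) (hyz : Commute y z) (heq : ∀ u ≤ γ, x u = y u)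
    (hne : ∀ t > γ, ∃ u ≤ t, x u ≠ y u) : z γ = γ := by
  have hz' : StrictMono (z⁻¹ : Equiv.Perm ℝ) := fun a b hab => by
    rw [← hz.lt_iff_lt]; simpa using hab
  refine le_antisymm (apply_le_of_commute_of_agree hz hxz hyz heq hne) ?_
  have h := hz.monotone
    (apply_le_of_commute_of_agree hz' hxz.inv_right hyz.inv_right heq hne)
  simpa using h

/-- If `z` commutes with a permutation `x` moving the points of `(α,β)` to the right, and `z` is
the identity immediately to the right of `α`, then `z` is the identity on `(α,β)`. -/
lemma apply_eq_of_commute_of_eq_near {x z : Equiv.Perm ℝ} {α β b : ℝ} (hx : StrictMono x)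
    (hxα : x α = α) (hlt : ∀ t ∈ Ioo α β, t < x t) (hxz : Commute x z) (hb : α < b)
    (hzb : ∀ t ∈ Ioo α b, z t = t) {t : ℝ} (ht : t ∈ Ioo α β) : z t = t := by
  by_contra hzt
  let S : Set ℝ := {u | u ∈ Ioo α β ∧ z u ≠ u}
  have hbd : BddBelow S := ⟨α, fun u hu => hu.1.1.le⟩
  have hbS : b ≤ sInf S := le_csInf ⟨t, ht, hzt⟩ fun u hu => by
    by_contra! h
    exact hu.2 (hzb u ⟨hu.1.1, h⟩)
  have hi : sInf S ∈ Ioo α β := ⟨hb.trans_le hbS, (csInf_le hbd ⟨ht, hzt⟩).trans_lt ht.2⟩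
  obtain ⟨u, hu, hux⟩ := exists_lt_of_csInf_lt (s := S) ⟨t, ht, hzt⟩ (hlt _ hi)
  obtain ⟨v, rfl⟩ := x.surjective u
  have hvi : v < sInf S := hx.lt_iff_lt.1 hux
  have hv : v ∈ Ioo α β := ⟨hx.lt_iff_lt.1 (hxα.symm ▸ hu.1.1), hvi.trans hi.2⟩
  have hzv : z v = v := by
    by_contra h
    exact (csInf_le hbd ⟨hv, h⟩).not_gt hvi
  exact hu.2 (by rw [← Equiv.Perm.apply_apply_of_commute hxz, hzv])

lemma IsSlopeSubgroup.exists_lt_one {L : Set ℝ} (hL : IsSlopeSubgroup L) (hLne : L ≠ {1}) :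
    ∃ p ∈ L, p < 1 := by
  obtain ⟨hpos, h1, -, hinv⟩ := hL
  by_contra! h
  refine hLne (Subset.antisymm (fun q hq => ?_) (by simpa using h1))
  refine le_antisymm ?_ (h q hq)
  exact (one_le_inv₀ (hpos q hq)).1 (h _ (hinv q hq))

lemma IsSlopeModule.pow_mul_mem {r p a : ℝ} {L A : Set ℝ} (hA : IsSlopeModule r L A)
    (hp : p ∈ L) (ha : a ∈ A) (n : ℕ) : p ^ n * a ∈ A := by
  induction n with
  | zero => simpa using ha
  | succ n ih =>
    rw [pow_succ', mul_assoc]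
    exact hA.2.2.2.2 p hp _ ih

/-- An element of `F_(α,β)` commuting with two bumps of different sizes is trivial. -/
lemma eq_one_of_commute_bumpPerm {r α β p s : ℝ} {L A : Set ℝ} {z : Equiv.Perm ℝ}
    (hp : 0 < p) (hp1 : p < 1) (hs : 0 < s) (hsβ : s + p⁻¹ * s < β - α)
    (hz : memFS r L A (Ioo α β) z) (hxz : Commute (bumpPerm α β s hp hp1) z)
    (hyz : Commute (bumpPerm α β (p * s) hp hp1) z) : z = 1 := by
  have hq : 1 < p⁻¹ := (one_lt_inv₀ hp).2 hp1
  have hqs : 0 < p⁻¹ * s := by positivity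
  have hps : 0 < p * s := by positivity
  have hps' : p * s < s := by nlinarith
  have hpsβ : p * s + p⁻¹ * (p * s) < β - α := by
    rw [inv_mul_cancel_left₀ hp.ne']; nlinarith
  have hfix : z (α + p * s) = α + p * s := by
    refine apply_eq_of_commute_of_agree hz.1.strictMono hxz hyz (fun u hu => ?_) fun t ht => ?_
    · simp only [bumpPerm_apply]
      rcases le_or_gt u α with h | h
      · rw [bump_of_le_left hp hp1 h, bump_of_le_left hp hp1 h]
      · rw [bump_of_mem_first hp hp1 hs hsβ ⟨h.le, by linarith⟩,
          bump_of_mem_first hp hp1 hps hpsβ ⟨h.le, hu⟩]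
    · refine ⟨min t (α + s), min_le_left _ _, ne_of_gt ?_⟩
      have h1 : α + p * s < min t (α + s) := lt_min ht (by linarith)
      have h2 : min t (α + s) ≤ α + s := min_le_right _ _
      generalize min t (α + s) = u at h1 h2
      simp only [bumpPerm_apply]
      rw [bump_of_mem_first hp hp1 hs hsβ ⟨by linarith, h2⟩]
      refine (bump_le hp hp1 hps ⟨by linarith, by linarith⟩).trans_lt ?_
      nlinarith
  have hseq : ∀ n : ℕ, z (α + p ^ n * (p * s)) = α + p ^ n * (p * s) := by
    intro n
    induction n with
    | zero => simpa using hfix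
    | succ n ih =>
      have hx : bumpPerm α β s hp hp1 (α + p ^ (n + 1) * (p * s)) = α + p ^ n * (p * s) := by
        have h1 : p ^ (n + 1) ≤ 1 := pow_le_one₀ hp.le hp1.le
        have h2 : 0 < p ^ (n + 1) := by positivity
        rw [bumpPerm_apply, bump_of_mem_first hp hp1 hs hsβ ⟨by nlinarith, by nlinarith⟩]
        field_simp
        ring
      apply (bumpPerm α β s hp hp1).injective
      rw [Equiv.Perm.apply_apply_of_commute hxz, hx, ih]
  obtain ⟨k, b, hb, m, hm⟩ := hz.1.2.2.exists_hasRightSlope α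
  obtain ⟨n, hn⟩ := exists_pow_lt_of_lt_one (div_pos (sub_pos.2 hb) hps) hp1
  rw [lt_div_iff₀ hps] at hn
  have hn0 : 0 < p ^ n * (p * s) := by positivity
  have hn1 : p ^ (n + 1) * (p * s) = p * (p ^ n * (p * s)) := by ring
  have e1 := hseq n
  have e2 := hseq (n + 1)
  rw [hn1] at e2
  generalize p ^ n * (p * s) = w at hn hn0 e1 e2
  rw [hm _ ⟨by linarith, by linarith⟩] at e1
  rw [hm _ ⟨by nlinarith, by nlinarith⟩] at e2
  have hk : k = 1 := by
    have h : (k - 1) * ((1 - p) * w) = 0 := by linear_combination e1 - e2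
    have h' : (1 - p) * w ≠ 0 := (mul_pos (by linarith) hn0).ne'
    linarith [(mul_eq_zero.1 h).resolve_right h']
  subst hk
  ext t
  rw [Equiv.Perm.one_apply]
  by_cases ht : t ∈ Ioo α β
  · refine apply_eq_of_commute_of_eq_near (strictMono_bump hp) (bump_of_le_left hp hp1 le_rfl)
      (fun u hu => lt_bump hp hp1 hs hu) hxz hb (fun u hu => ?_) ht
    rw [hm u hu]
    linarith
  · by_contra h
    exact ht (hz.2 h)

/-- For all `α, β ∈ A` with `0 < α < β < r` there exist
`x, y ∈ F` with `supp x = supp y = (α,β)` which do not commute and whose common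
centralizer in `F_{(α,β)}` is trivial. -/
theorem exists_noncommuting_trivial_centralizer (r : ℝ) (L A : Set ℝ) (hr : 0 < r)
    (hL : IsSlopeSubgroup L) (hLne : L ≠ {1}) (hA : IsSlopeModule r L A)
    (α β : ℝ) (hαA : α ∈ A) (hβA : β ∈ A) (h0α : 0 < α) (hαβ : α < β) (hβr : β < r) :
    ∃ x y : Equiv.Perm ℝ, memF r L A x ∧ memF r L A y ∧
      psupp x = Ioo α β ∧ psupp y = Ioo α β ∧ ¬ Commute x y ∧
      {z : Equiv.Perm ℝ | memFS r L A (Ioo α β) z ∧ Commute x z ∧ Commute y z} =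
        {(1 : Equiv.Perm ℝ)} := by
  obtain ⟨p, hpL, hp1⟩ := hL.exists_lt_one hLne
  have hp : 0 < p := hL.1 p hpL
  have hq : 0 < p⁻¹ := inv_pos.2 hp
  have hd : 0 < β - α := sub_pos.2 hαβ
  have hdA : β - α ∈ A := sub_eq_add_neg β α ▸ hA.2.2.1 _ hβA _ (hA.2.2.2.1 _ hαA)
  obtain ⟨n, hn⟩ := exists_pow_lt_of_lt_one (show (0 : ℝ) < 1 / (1 + p⁻¹) by positivity) hp1
  rw [lt_div_iff₀ (by positivity)] at hn
  obtain ⟨s, hs, hsA, hsβ⟩ : ∃ s : ℝ, 0 < s ∧ s ∈ A ∧ s + p⁻¹ * s < β - α :=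
    ⟨p ^ n * (β - α), by positivity, hA.pow_mul_mem hpL hdA n, by nlinarith⟩
  have hps : 0 < p * s := mul_pos hp hs
  have hpsβ : p * s + p⁻¹ * (p * s) < β - α := by nlinarith
  have hone : ∀ z : Equiv.Perm ℝ, memFS r L A (Ioo α β) z →
      Commute (bumpPerm α β s hp hp1) z → Commute (bumpPerm α β (p * s) hp hp1) z → z = 1 :=
    fun z hz hxz hyz => eq_one_of_commute_bumpPerm hp hp1 hs hsβ hz hxz hyz
  have hx := memF_bumpPerm hL hA hαA hβA h0α hβr hp hp1 hpL hs hsA hsβ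
  have hy := memF_bumpPerm hL hA hαA hβA h0α hβr hp hp1 hpL hps (hA.2.2.2.2 p hpL s hsA) hpsβ
  have hsx := psupp_bumpPerm (α := α) (β := β) hp hp1 hs
  refine ⟨bumpPerm α β s hp hp1, bumpPerm α β (p * s) hp hp1, hx, hy, hsx,
    psupp_bumpPerm hp hp1 hps, fun hxy => ?_, Subset.antisymm ?_ ?_⟩
  · have h1 := hone _ ⟨hx, hsx.subset⟩ (Commute.refl _) hxy.symm
    obtain ⟨t, ht⟩ := nonempty_Ioo.2 hαβ
    rw [← hsx, h1] at ht
    exact ht rfl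
  · rintro z ⟨hz, hxz, hyz⟩
    exact hone z hz hxz hyz
  · rintro z rfl
    refine ⟨⟨⟨fun t _ => rfl, continuous_id, ∅, by simp, by simp, fun t _ => ?_⟩, ?_⟩,
      Commute.one_right _, Commute.one_right _⟩
    · exact ⟨1, one_pos, 1, hL.2.1, 0, fun u _ => by simp⟩
    · exact fun t ht => (ht rfl).elim
end

section
/- For all integers n and k: n = k·(k+1) if and only if both (for every integer m, n ∣ m if and only if k ∣ m and (k+1) ∣ m) and (2k+1) ∣ (2n − k). -/
/-- Julia Robinson.  For all integers `n` and `k`: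
`n = k(k+1)` if and only if both (for every integer `m`, `n ∣ m ↔ k ∣ m ∧ (k+1) ∣ m`)
and `(2k+1) ∣ (2n − k)`. -/
theorem int_eq_mul_succ_iff (n k : ℤ) :
    n = k * (k + 1) ↔
      ((∀ m : ℤ, n ∣ m ↔ k ∣ m ∧ (k + 1) ∣ m) ∧ (2 * k + 1) ∣ (2 * n - k)) := by
  have hc : IsCoprime k (k + 1) := ⟨-1, 1, by ring⟩
  constructor
  · rintro rfl
    exact ⟨fun m => ⟨fun h => ⟨(dvd_mul_right _ _).trans h, (dvd_mul_left _ _).trans h⟩,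
      fun h => hc.mul_dvd h.1 h.2⟩, k, by ring⟩
  · rintro ⟨hm, hd⟩
    have h₁ : n ∣ k * (k + 1) := (hm _).2 ⟨dvd_mul_right _ _, dvd_mul_left _ _⟩
    have h₂ : k * (k + 1) ∣ n := hc.mul_dvd ((hm n).1 dvd_rfl).1 ((hm n).1 dvd_rfl).2
    rcases Int.associated_iff.1 (associated_of_dvd_dvd h₁ h₂) with h | h
    · exact h
    · have h_one : 2 * k + 1 ∣ 1 := by
        have := dvd_add hd (dvd_mul_left (2 * k + 1) (k + 1))
        rwa [h, show 2 * -(k * (k + 1)) - k + (k + 1) * (2 * k + 1) = 1 by ring] at this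
      have hk : k = 0 ∨ k = -1 := by
        rcases Int.isUnit_iff.1 (isUnit_of_dvd_one h_one) with h' | h' <;> omega
      rcases hk with rfl | rfl <;> simpa using h
end

section
/- In G = ℤ ≀ ℤ (notation below): for every nonzero integer n, the centralizer of b·aⁿ in G equals the cyclic subgroup ⟨b·aⁿ⟩; and for every integer n, the product set H·C_G(b·aⁿ) equals the product set H·⟨aⁿ⟩, where H is identified with the base subgroup H × {0} of G. -/
open Pointwise

/-- The shift `e_k ↦ e_{k+n}` on the free abelian group `⨁_{k∈ℤ} ℤ` (= `ℤ →₀ ℤ`). -/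
noncomputable def shiftAut (n : ℤ) : (ℤ →₀ ℤ) ≃+ (ℤ →₀ ℤ) :=
  Finsupp.domCongr (Equiv.addRight n)

/-- The action of `ℤ` on `⨁_{k∈ℤ} ℤ` by shifting the coordinates. -/
noncomputable def shiftHom :
    Multiplicative ℤ →* MulAut (Multiplicative (ℤ →₀ ℤ)) :=
  MonoidHom.mk' (fun n => AddEquiv.toMultiplicative (shiftAut n.toAdd))
    (by
      intro m n
      refine MulEquiv.ext fun x => ?_
      show Multiplicative.ofAdd (shiftAut (m.toAdd + n.toAdd) x.toAdd) =
        Multiplicative.ofAdd (shiftAut m.toAdd (shiftAut n.toAdd x.toAdd))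
      congr 1
      ext k
      simp [shiftAut, Finsupp.domCongr_apply, Finsupp.equivMapDomain_apply, sub_sub,
        add_comm, Equiv.Perm.mul_def, Equiv.symm_trans_apply]
      congr 1
      ring)

/-- The restricted wreath product `ℤ ≀ ℤ = (⨁_{k∈ℤ} ℤ) ⋊ ℤ`, with `ℤ` acting by
shifting the coordinates. -/
abbrev ZwrZ : Type :=
  SemidirectProduct (Multiplicative (ℤ →₀ ℤ)) (Multiplicative ℤ) shiftHom

/-- The element `a = (0, 1)` of `ℤ ≀ ℤ`. -/
noncomputable def wa : ZwrZ := SemidirectProduct.inr (Multiplicative.ofAdd (1 : ℤ))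

/-- The element `b = (e₀, 0)` of `ℤ ≀ ℤ`. -/
noncomputable def wb : ZwrZ :=
  SemidirectProduct.inl (Multiplicative.ofAdd (Finsupp.single (0 : ℤ) (1 : ℤ)))

/-- The base subgroup `H × {0}` of `ℤ ≀ ℤ`, where `H = ⨁_{k∈ℤ} ℤ`. -/
noncomputable def baseH : Subgroup ZwrZ :=
  (SemidirectProduct.inl : Multiplicative (ℤ →₀ ℤ) →* ZwrZ).range

theorem toAdd_shiftHom (m : Multiplicative ℤ) (x : Multiplicative (ℤ →₀ ℤ)) :
    (shiftHom m x).toAdd = shiftAut m.toAdd x.toAdd := rfl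

theorem shiftAut_apply (n : ℤ) (h : ℤ →₀ ℤ) (k : ℤ) : shiftAut n h k = h (k - n) := by
  simp [shiftAut, Finsupp.domCongr_apply, Finsupp.equivMapDomain_apply, sub_eq_add_neg]

theorem shiftAut_eq_mapDomain (n : ℤ) (h : ℤ →₀ ℤ) :
    shiftAut n h = Finsupp.mapDomain (· + n) h := by
  simp [shiftAut, Finsupp.domCongr_apply, Finsupp.equivMapDomain_eq_mapDomain]

theorem eq_zero_of_shiftAut_eq_self {n : ℤ} (hn : n ≠ 0) {h : ℤ →₀ ℤ}
    (hh : shiftAut n h = h) : h = 0 := by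
  by_contra hne
  obtain ⟨k, hk⟩ := Finsupp.support_nonempty_iff.mpr hne
  have hper (x : ℤ) : h (x + n) = h x := by
    have := shiftAut_apply n h (x + n)
    rwa [hh, add_sub_cancel_right] at this
  have hmem (j : ℕ) : k + j * n ∈ (h.support : Set ℤ) := by
    induction j with
    | zero => simpa using hk
    | succ j ih =>
      have := hper (k + j * n)
      simp only [Finset.mem_coe, Finsupp.mem_support_iff] at ih ⊢
      rwa [Nat.cast_succ, add_one_mul, ← add_assoc, this]
  have hinj : Function.Injective fun j : ℕ => k + (j : ℤ) * n := fun i j hij => by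
    simpa [hn] using hij
  exact Set.infinite_of_injective_forall_mem hinj hmem h.support.finite_toSet

/-- Reducing indices modulo `n` turns the shift by `n` into the identity. -/
theorem mapDomain_zmod_shiftAut (n : ℤ) (h : ℤ →₀ ℤ) :
    Finsupp.mapDomain (Int.cast : ℤ → ZMod n.natAbs) (shiftAut n h) =
      Finsupp.mapDomain Int.cast h := by
  rw [shiftAut_eq_mapDomain, ← Finsupp.mapDomain_comp]
  congr 1
  ext k
  have : (n : ZMod n.natAbs) = 0 :=
    (ZMod.intCast_zmod_eq_zero_iff_dvd n _).mpr (Int.natAbs_dvd.mpr dvd_rfl)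
  simp [this]

theorem wa_zpow (n : ℤ) : wa ^ n = SemidirectProduct.inr (Multiplicative.ofAdd n) := by
  rw [wa, ← map_zpow, ← ofAdd_zsmul, smul_eq_mul, mul_one]

theorem rightHom_wb_mul_wa_zpow (n : ℤ) :
    SemidirectProduct.rightHom (wb * wa ^ n) = Multiplicative.ofAdd n := by
  simp [wa_zpow, wb]

theorem left_toAdd_of_mem_centralizer {n : ℤ} {x : ZwrZ}
    (hx : x ∈ Subgroup.centralizer {wb * wa ^ n}) :
    Finsupp.single 0 1 + shiftAut n x.left.toAdd =
      x.left.toAdd + shiftAut x.right.toAdd (Finsupp.single 0 1) := by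
  have := congrArg (fun y : ZwrZ => y.left.toAdd) (Subgroup.mem_centralizer_singleton_iff.mp hx)
  simpa [wa_zpow, wb, toAdd_shiftHom] using this.symm

theorem dvd_right_of_mem_centralizer {n : ℤ} {x : ZwrZ}
    (hx : x ∈ Subgroup.centralizer {wb * wa ^ n}) : n ∣ x.right.toAdd := by
  have h := congrArg (Finsupp.mapDomain (Int.cast : ℤ → ZMod n.natAbs))
    (left_toAdd_of_mem_centralizer hx)
  rw [Finsupp.mapDomain_add, Finsupp.mapDomain_add, mapDomain_zmod_shiftAut, add_comm,
    add_right_inj, shiftAut_eq_mapDomain, Finsupp.mapDomain_single, Finsupp.mapDomain_single,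
    Finsupp.mapDomain_single, Finsupp.single_left_inj one_ne_zero, Int.cast_zero, zero_add] at h
  exact Int.natAbs_dvd.mp ((ZMod.intCast_zmod_eq_zero_iff_dvd _ _).mp h.symm)

theorem map_rightHom_centralizer (n : ℤ) :
    (Subgroup.centralizer {wb * wa ^ n}).map SemidirectProduct.rightHom =
      Subgroup.zpowers (Multiplicative.ofAdd n) := by
  apply le_antisymm
  · rintro _ ⟨x, hx, rfl⟩
    obtain ⟨q, hq⟩ := dvd_right_of_mem_centralizer hx
    refine ⟨q, Multiplicative.toAdd.injective ?_⟩
    simp [hq, mul_comm]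
  · rw [Subgroup.zpowers_le]
    exact ⟨_, Subgroup.mem_centralizer_singleton_iff.mpr rfl, rightHom_wb_mul_wa_zpow n⟩

theorem centralizer_wb_mul_wa_zpow {n : ℤ} (hn : n ≠ 0) :
    Subgroup.centralizer {wb * wa ^ n} = Subgroup.zpowers (wb * wa ^ n) := by
  have hle : Subgroup.zpowers (wb * wa ^ n) ≤ Subgroup.centralizer {wb * wa ^ n} :=
    Subgroup.zpowers_le.mpr (Subgroup.mem_centralizer_singleton_iff.mpr rfl)
  refine le_antisymm (fun x hx => ?_) hle
  obtain ⟨q, hq⟩ : SemidirectProduct.rightHom x ∈ Subgroup.zpowers (Multiplicative.ofAdd n) :=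
    map_rightHom_centralizer n ▸ Subgroup.mem_map_of_mem _ hx
  set w := wb * wa ^ n
  have hy : x * (w ^ q)⁻¹ ∈ Subgroup.centralizer {w} :=
    mul_mem hx (inv_mem (hle ⟨q, rfl⟩))
  have hright : (x * (w ^ q)⁻¹).right = 1 := by
    rw [← SemidirectProduct.rightHom_eq_right, map_mul, map_inv, map_zpow,
      rightHom_wb_mul_wa_zpow, ← hq, mul_inv_cancel]
  have hleft := left_toAdd_of_mem_centralizer hy
  rw [hright, toAdd_one, shiftAut_eq_mapDomain 0, Finsupp.mapDomain_single, add_zero, add_comm,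
    add_left_inj] at hleft
  have hone : x * (w ^ q)⁻¹ = 1 :=
    SemidirectProduct.ext (Multiplicative.toAdd.injective (eq_zero_of_shiftAut_eq_self hn hleft))
      hright
  exact ⟨q, (mul_inv_eq_one.mp hone).symm⟩

theorem baseH_mul_eq_of_map_rightHom_eq {K L : Subgroup ZwrZ}
    (h : K.map SemidirectProduct.rightHom = L.map SemidirectProduct.rightHom) :
    (baseH : Set ZwrZ) * (K : Set ZwrZ) = (baseH : Set ZwrZ) * (L : Set ZwrZ) := by
  have hker : baseH = (SemidirectProduct.rightHom : ZwrZ →* _).ker :=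
    SemidirectProduct.range_inl_eq_ker_rightHom
  rw [hker, ← Subgroup.normal_mul, ← Subgroup.normal_mul, sup_comm, sup_comm _ L,
    ← Subgroup.comap_map_eq, ← Subgroup.comap_map_eq, h]

/-- In `G = ℤ ≀ ℤ`: for every nonzero `n ∈ ℤ`, the centralizer of
`b·aⁿ` is the cyclic subgroup `⟨b·aⁿ⟩`; and for every `n ∈ ℤ`,
`H·C_G(b·aⁿ) = H·⟨aⁿ⟩` as product sets. -/
theorem centralizer_wb_wa_pow :
    (∀ n : ℤ, n ≠ 0 →
      Subgroup.centralizer {wb * wa ^ n} = Subgroup.zpowers (wb * wa ^ n)) ∧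
    (∀ n : ℤ,
      (baseH : Set ZwrZ) * (Subgroup.centralizer {wb * wa ^ n} : Set ZwrZ) =
        (baseH : Set ZwrZ) * (Subgroup.zpowers (wa ^ n) : Set ZwrZ)) := by
  refine ⟨fun n hn => centralizer_wb_mul_wa_zpow hn, fun n => baseH_mul_eq_of_map_rightHom_eq ?_⟩
  rw [map_rightHom_centralizer, MonoidHom.map_zpowers, wa_zpow, SemidirectProduct.rightHom_inr]
end
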